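/- For every integer s ≥ 1, dim_{F_2}(QP_4)_{2^{s+1}−1} equals 14 if s = 1, equals 35 if s = 2, equals 75 if s = 3, equals 89 if s = 4, and equals 85 if s ≥ 5. -/

import Mathlib

open MvPolynomial

/-- The total Steenrod square on `P_k = F_2[x_1,…,x_k]`, the algebra map with
`Sq(x_j) = x_j + x_j^2`. -/
noncomputable def SqTotal (k : ℕ) :
    MvPolynomial (Fin k) (ZMod 2) →ₐ[ZMod 2] MvPolynomial (Fin k) (ZMod 2) :=
  aeval fun j => X j + X j ^ 2

/-- The Steenrod square `Sq^i : P_k → P_k`, sending a homogeneous polynomial `f` of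
degree `d` to the degree-`d + i` homogeneous component of `Sq(f)`, extended additively. -/
noncomputable def SqOp (k i : ℕ) (f : MvPolynomial (Fin k) (ZMod 2)) :
    MvPolynomial (Fin k) (ZMod 2) :=
  ∑ d ∈ Finset.range (f.totalDegree + 1),
    homogeneousComponent (d + i) (SqTotal k (homogeneousComponent d f))

/-- The space of hit polynomials: finite sums of `Sq^i (f_i)` with `i > 0`. -/
noncomputable def hitSubmodule (k : ℕ) :
    Submodule (ZMod 2) (MvPolynomial (Fin k) (ZMod 2)) :=
  Submodule.span (ZMod 2) {g | ∃ i f, 0 < i ∧ g = SqOp k i f}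

/-- A polynomial is hit if it is a finite sum of `Sq^i (f_i)` with `i > 0`. -/
def IsHit (k : ℕ) (f : MvPolynomial (Fin k) (ZMod 2)) : Prop := f ∈ hitSubmodule k

/-- `(QP_k)_n`: the space of homogeneous polynomials of degree `n` modulo hit polynomials. -/
abbrev QP (k n : ℕ) :=
  ↥(homogeneousSubmodule (Fin k) (ZMod 2) n) ⧸
    ((hitSubmodule k).comap (homogeneousSubmodule (Fin k) (ZMod 2) n).subtype)

namespace HitProblem

section BinomialSums

variable {M N : Type*} [AddCommGroup M] [Module (ZMod 2) M] [AddCommGroup N] [Module (ZMod 2) N]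

/-- The sum of `Φ b` over all `b`, weighted by the binomial coefficients `a.choose b` mod 2. -/
def binSum (a : ℕ) (Φ : ℕ → M) : M := ∑ b ∈ Finset.range (a + 1), (a.choose b : ZMod 2) • Φ b

lemma binSum_eq_sum_range {a n : ℕ} (h : a < n) (Φ : ℕ → M) :
    binSum a Φ = ∑ b ∈ Finset.range n, (a.choose b : ZMod 2) • Φ b := by
  refine Finset.sum_subset (by simpa using h) fun b _ hb => ?_
  rw [Nat.choose_eq_zero_of_lt (by simpa using hb)]
  simp

lemma choose_cast_eq (n k : ℕ) :
    (n.choose k : ZMod 2) = ((n % 2).choose (k % 2) : ZMod 2) * ((n / 2).choose (k / 2) : ZMod 2) := by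
  have h := Choose.choose_modEq_choose_mod_mul_choose_div_nat (p := 2) (n := n) (k := k)
  have := (ZMod.natCast_eq_natCast_iff _ _ 2).2 h
  simpa using this

lemma binSum_add_two_mul {e : ℕ} (he : e < 2) (a : ℕ) (Φ : ℕ → M) :
    binSum (e + 2 * a) Φ = ∑ β ∈ Finset.range (e + 1), binSum a fun b => Φ (β + 2 * b) := by
  have key : ∀ (F : ℕ → M) (n : ℕ), ∑ b ∈ Finset.range (2 * n), F b =
      ∑ b ∈ Finset.range n, (F (0 + 2 * b) + F (1 + 2 * b)) := by
    intro F n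
    induction n with
    | zero => simp
    | succ n ih =>
      rw [Finset.sum_range_succ, ← ih, Nat.mul_succ, Finset.sum_range_succ, Finset.sum_range_succ,
        zero_add, add_comm 1, add_assoc]
  rw [binSum_eq_sum_range (n := 2 * (a + 1)) (by omega), key]
  have h0 : ∀ b, ((e + 2 * a).choose (0 + 2 * b) : ZMod 2) = (a.choose b : ZMod 2) := by
    intro b
    rw [choose_cast_eq, show (e + 2 * a) / 2 = a by omega, show (0 + 2 * b) % 2 = 0 by omega,
      show (0 + 2 * b) / 2 = b by omega]
    simp
  interval_cases e
  · have h1 : ∀ b, ((0 + 2 * a).choose (1 + 2 * b) : ZMod 2) = 0 := by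
      intro b
      rw [choose_cast_eq, show (0 + 2 * a) % 2 = 0 by omega, show (1 + 2 * b) % 2 = 1 by omega]
      simp
    simp only [h0, h1, zero_smul, add_zero, binSum]
    rw [Finset.sum_range_one]
  · have h1 : ∀ b, ((1 + 2 * a).choose (1 + 2 * b) : ZMod 2) = (a.choose b : ZMod 2) := by
      intro b
      rw [choose_cast_eq, show (1 + 2 * a) % 2 = 1 by omega, show (1 + 2 * b) % 2 = 1 by omega,
        show (1 + 2 * a) / 2 = a by omega, show (1 + 2 * b) / 2 = b by omega]
      simp
    rw [Finset.sum_range_succ (n := 1), Finset.sum_range_one]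
    simp only [h0, h1, Finset.sum_add_distrib, binSum]

lemma binSum_zero_left (Φ : ℕ → M) : binSum 0 Φ = Φ 0 := by simp [binSum]

lemma binSum_zero (a : ℕ) : binSum a (fun _ => (0 : M)) = 0 := by simp [binSum]

lemma binSum_sum {ι : Type*} (s : Finset ι) (a : ℕ) (Φ : ι → ℕ → M) :
    binSum a (fun b => ∑ i ∈ s, Φ i b) = ∑ i ∈ s, binSum a (Φ i) := by
  simp only [binSum, Finset.smul_sum]
  exact Finset.sum_comm

lemma map_binSum (f : M →ₗ[ZMod 2] N) (a : ℕ) (Φ : ℕ → M) :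
    f (binSum a Φ) = binSum a fun b => f (Φ b) := by
  simp [binSum, map_sum]

lemma binSum_mem (S : Submodule (ZMod 2) M) (a : ℕ) {Φ : ℕ → M} (h : ∀ b, Φ b ∈ S) :
    binSum a Φ ∈ S :=
  S.sum_mem fun b _ => S.smul_mem _ (h b)

lemma binSum_add_two_pow_mul (r : ℕ) {a : ℕ} (ha : a < 2 ^ r) (y : ℕ) {Φ : ℕ → M}
    (hΦ : ∀ b, 2 ^ r ≤ b → Φ b = 0) : binSum (a + 2 ^ r * y) Φ = binSum a Φ := by
  induction r generalizing a Φ with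
  | zero =>
    obtain rfl : a = 0 := by simpa using ha
    rw [binSum_zero_left, binSum, Finset.sum_eq_single 0]
    · simp
    · intro b _ hb
      rw [hΦ b (by simpa using Nat.one_le_iff_ne_zero.2 hb), smul_zero]
    · simp
  | succ r ih =>
    rw [pow_succ] at ha
    have h1 : a + 2 ^ (r + 1) * y = a % 2 + 2 * (a / 2 + 2 ^ r * y) := by
      rw [pow_succ]
      have : 2 ^ r * 2 * y = 2 * (2 ^ r * y) := by ring
      omega
    conv_rhs => rw [← Nat.mod_add_div a 2]
    rw [h1, binSum_add_two_mul (Nat.mod_lt _ two_pos), binSum_add_two_mul (Nat.mod_lt _ two_pos)]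
    refine Finset.sum_congr rfl fun β _ => ih (by omega) fun b hb => hΦ _ ?_
    rw [pow_succ]
    omega

lemma binSum_two_pow_sub_one (p : ℕ) (i : ℕ) (x : M) :
    binSum i (fun b => if i + b = 2 ^ p - 1 then x else 0) = if i = 2 ^ p - 1 then x else 0 := by
  induction p generalizing i with
  | zero =>
    rcases i with _ | i
    · simp [binSum_zero_left]
    · simp [binSum]
  | succ p ih =>
    have hp : 2 ^ (p + 1) - 1 = 1 + 2 * (2 ^ p - 1) := by
      have := Nat.one_le_two_pow (n := p)
      rw [pow_succ]
      omega
    obtain ⟨e, he, j, rfl⟩ : ∃ e < 2, ∃ j, i = e + 2 * j :=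
      ⟨i % 2, Nat.mod_lt _ two_pos, i / 2, (Nat.mod_add_div i 2).symm⟩
    rw [binSum_add_two_mul he, hp]
    interval_cases e
    · rw [Finset.sum_range_one, if_neg (by omega)]
      have : ∀ b, ¬ (0 + 2 * j + (0 + 2 * b) = 1 + 2 * (2 ^ p - 1)) := by intro b; omega
      simp only [this, if_false, binSum_zero]
    · rw [Finset.sum_range_succ, Finset.sum_range_one]
      have h1 : ∀ b, ¬ (1 + 2 * j + (1 + 2 * b) = 1 + 2 * (2 ^ p - 1)) := by intro b; omega
      have h2 : ∀ b, (1 + 2 * j + (0 + 2 * b) = 1 + 2 * (2 ^ p - 1)) ↔ (j + b = 2 ^ p - 1) := by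
        intro b; omega
      have h3 : (1 + 2 * j = 1 + 2 * (2 ^ p - 1)) ↔ (j = 2 ^ p - 1) := by omega
      simp only [h1, h2, h3, if_false, binSum_zero, add_zero, ih]

end BinomialSums

/-- Exponents of monomials in four variables. -/
abbrev Expo := ℕ × ℕ × ℕ × ℕ

/-- The degree of the monomial with exponent `a`. -/
def deg (a : Expo) : ℕ := a.1 + a.2.1 + a.2.2.1 + a.2.2.2

lemma deg_add (a b : Expo) : deg (a + b) = deg a + deg b := by
  simp only [deg, Prod.fst_add, Prod.snd_add]
  omega

lemma deg_nsmul (n : ℕ) (a : Expo) : deg (n • a) = n * deg a := by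
  simp only [deg, Prod.smul_fst, Prod.smul_snd, smul_eq_mul]
  ring

section FourVariables

variable {M N : Type*} [AddCommGroup M] [Module (ZMod 2) M] [AddCommGroup N] [Module (ZMod 2) N]

/-- The four-variable analogue of `binSum`. -/
def multiBinSum (a : Expo) (Φ : Expo → M) : M :=
  binSum a.1 fun b₀ => binSum a.2.1 fun b₁ => binSum a.2.2.1 fun b₂ => binSum a.2.2.2 fun b₃ =>
    Φ (b₀, b₁, b₂, b₃)

lemma multiBinSum_zero_left (Φ : Expo → M) : multiBinSum 0 Φ = Φ 0 := by
  simp only [multiBinSum, Prod.fst_zero, Prod.snd_zero, binSum_zero_left]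
  rfl

lemma multiBinSum_zero (a : Expo) : multiBinSum a (fun _ => (0 : M)) = 0 := by
  simp [multiBinSum, binSum_zero]

lemma multiBinSum_sum {ι : Type*} (s : Finset ι) (a : Expo) (Φ : ι → Expo → M) :
    multiBinSum a (fun b => ∑ i ∈ s, Φ i b) = ∑ i ∈ s, multiBinSum a (Φ i) := by
  simp only [multiBinSum, binSum_sum]

lemma map_multiBinSum (f : M →ₗ[ZMod 2] N) (a : Expo) (Φ : Expo → M) :
    f (multiBinSum a Φ) = multiBinSum a fun b => f (Φ b) := by
  simp only [multiBinSum, map_binSum]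

lemma multiBinSum_mem (S : Submodule (ZMod 2) M) (a : Expo) {Φ : Expo → M} (h : ∀ b, Φ b ∈ S) :
    multiBinSum a Φ ∈ S :=
  binSum_mem S _ fun _ => binSum_mem S _ fun _ => binSum_mem S _ fun _ => binSum_mem S _ fun _ => h _

lemma Iic_prod {α β : Type*} [Preorder α] [Preorder β] [LocallyFiniteOrderBot α]
    [LocallyFiniteOrderBot β] [DecidableLE α] [DecidableLE β] (a : α) (b : β) :
    Finset.Iic (a, b) = Finset.Iic a ×ˢ Finset.Iic b := by
  ext ⟨x, y⟩
  simp [Prod.le_def]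

lemma multiBinSum_add_two_nsmul {ε : Expo} (hε : ε ≤ (1, 1, 1, 1)) (a : Expo) (Φ : Expo → M) :
    multiBinSum (ε + 2 • a) Φ =
      ∑ β ∈ Finset.Iic ε, multiBinSum a fun b => Φ (β + 2 • b) := by
  obtain ⟨e₀, e₁, e₂, e₃⟩ := ε
  obtain ⟨a₀, a₁, a₂, a₃⟩ := a
  obtain ⟨h₀, h₁, h₂, h₃⟩ := hε
  simp only at h₀ h₁ h₂ h₃
  simp only [multiBinSum, Prod.smul_mk, Prod.mk_add_mk, smul_eq_mul, Iic_prod, Finset.sum_product,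
    binSum_add_two_mul (Nat.lt_succ_of_le h₀), binSum_add_two_mul (Nat.lt_succ_of_le h₁),
    binSum_add_two_mul (Nat.lt_succ_of_le h₂), binSum_add_two_mul (Nat.lt_succ_of_le h₃),
    binSum_sum, ← Nat.range_succ_eq_Iic]

lemma multiBinSum_add_two_pow_nsmul (r : ℕ) {a : Expo} (ha : ∀ i ∈ [a.1, a.2.1, a.2.2.1, a.2.2.2], i < 2 ^ r)
    (y : Expo) {Φ : Expo → M} (hΦ : ∀ b, 2 ^ r ≤ deg b → Φ b = 0) :
    multiBinSum (a + 2 ^ r • y) Φ = multiBinSum a Φ := by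
  obtain ⟨a₀, a₁, a₂, a₃⟩ := a
  obtain ⟨y₀, y₁, y₂, y₃⟩ := y
  simp only [List.mem_cons, List.not_mem_nil, or_false, forall_eq_or_imp, forall_eq] at ha
  obtain ⟨h₀, h₁, h₂, h₃⟩ := ha
  simp only [multiBinSum, Prod.smul_mk, Prod.mk_add_mk, smul_eq_mul]
  rw [binSum_add_two_pow_mul r h₀]
  · congr 1; funext b₀
    rw [binSum_add_two_pow_mul r h₁]
    · congr 1; funext b₁
      rw [binSum_add_two_pow_mul r h₂]
      · congr 1; funext b₂
        exact binSum_add_two_pow_mul r h₃ _ fun b hb => hΦ _ (by simp only [deg]; omega)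
      · intro b hb
        simp only [fun z : ℕ => hΦ (b₀, b₁, b, z) (by simp only [deg]; omega), binSum_zero]
    · intro b hb
      simp only [fun x z : ℕ => hΦ (b₀, b, x, z) (by simp only [deg]; omega), binSum_zero]
  · intro b hb
    simp only [fun w x z : ℕ => hΦ (b, w, x, z) (by simp only [deg]; omega), binSum_zero]

/-- The formal action of `Sq^l` on a function of exponents: if `φ a` is the monomial with exponent
`a`, this is `Sq^l` of that monomial. -/
def sqAct (l : ℕ) (φ : Expo → M) (a : Expo) : M :=
  multiBinSum a fun b => if deg b = l then φ (a + b) else 0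

lemma map_sqAct (f : M →ₗ[ZMod 2] N) (l : ℕ) (φ : Expo → M) (a : Expo) :
    f (sqAct l φ a) = sqAct l (fun b => f (φ b)) a := by
  simp only [sqAct, map_multiBinSum, apply_ite f, map_zero]

end FourVariables

/-- The polynomial algebra `P_4`. -/
abbrev P4 := MvPolynomial (Fin 4) (ZMod 2)

/-- The monomial with exponent `a`. -/
noncomputable def mon (a : Expo) : P4 :=
  X 0 ^ a.1 * (X 1 ^ a.2.1 * (X 2 ^ a.2.2.1 * X 3 ^ a.2.2.2))

lemma isHomogeneous_mon (a : Expo) : (mon a).IsHomogeneous (deg a) := by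
  have h := (isHomogeneous_X_pow (R := ZMod 2) (0 : Fin 4) a.1).mul
    ((isHomogeneous_X_pow (1 : Fin 4) a.2.1).mul ((isHomogeneous_X_pow (2 : Fin 4) a.2.2.1).mul
      (isHomogeneous_X_pow (3 : Fin 4) a.2.2.2)))
  rwa [← add_assoc, ← add_assoc] at h

lemma mon_ne_zero (a : Expo) : mon a ≠ 0 := by
  simp only [mon, ne_eq, mul_eq_zero, pow_eq_zero_iff', X_ne_zero, false_and, or_self,
    not_false_eq_true]

lemma mon_add (a b : Expo) : mon (a + b) = mon a * mon b := by
  simp only [mon, Prod.fst_add, Prod.snd_add, pow_add]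
  ring

lemma mon_two_nsmul (a : Expo) : mon (2 • a) = mon a ^ 2 := by
  rw [two_nsmul, mon_add, pow_two]

lemma mon_eq_monomial (a : Expo) (m : Fin 4 →₀ ℕ)
    (h₀ : m 0 = a.1) (h₁ : m 1 = a.2.1) (h₂ : m 2 = a.2.2.1) (h₃ : m 3 = a.2.2.2) :
    mon a = monomial m 1 := by
  rw [monomial_eq, Finsupp.prod_fintype _ _ (by simp), Fin.prod_univ_four, h₀, h₁, h₂, h₃, mon, C_1]
  ring

lemma monomial_eq_mon (m : Fin 4 →₀ ℕ) : monomial m (1 : ZMod 2) = mon (m 0, m 1, m 2, m 3) :=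
  (mon_eq_monomial _ _ rfl rfl rfl rfl).symm

lemma add_sq_pow_eq_binSum {A : Type*} [CommRing A] [Algebra (ZMod 2) A] (x : A) (a : ℕ) :
    (x + x ^ 2) ^ a = binSum a fun b => x ^ (a + b) := by
  rw [add_comm, add_pow, binSum]
  refine Finset.sum_congr rfl fun b hb => ?_
  have : b ≤ a := by simpa [Nat.lt_succ_iff] using hb
  rw [← pow_mul, ← pow_add, show 2 * b + (a - b) = a + b by omega, Nat.cast_smul_eq_nsmul, nsmul_eq_mul, mul_comm]

lemma SqTotal_mon (a : Expo) : SqTotal 4 (mon a) = multiBinSum a fun b => mon (a + b) := by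
  have hl : ∀ (x : P4) (n : ℕ) (Φ : ℕ → P4), x * binSum n Φ = binSum n fun b => x * Φ b :=
    fun x n Φ => map_binSum (LinearMap.mulLeft (ZMod 2) x) n Φ
  have hr : ∀ (x : P4) (n : ℕ) (Φ : ℕ → P4), binSum n Φ * x = binSum n fun b => Φ b * x :=
    fun x n Φ => map_binSum (LinearMap.mulRight (ZMod 2) x) n Φ
  simp only [mon, SqTotal, map_mul, map_pow, aeval_X, add_sq_pow_eq_binSum, multiBinSum, hr]
  simp only [hl, Prod.fst_add, Prod.snd_add]

lemma homogeneousComponent_mon (n : ℕ) (a : Expo) :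
    homogeneousComponent n (mon a) = if deg a = n then mon a else 0 := by
  rw [homogeneousComponent_of_mem ((mem_homogeneousSubmodule _ _).2 (isHomogeneous_mon a))]
  simp only [eq_comm]

lemma homogeneousComponent_SqTotal_mon (l : ℕ) (a : Expo) :
    homogeneousComponent (deg a + l) (SqTotal 4 (mon a)) = sqAct l mon a := by
  rw [SqTotal_mon, map_multiBinSum]
  simp only [homogeneousComponent_mon, deg_add, add_right_inj, sqAct]

lemma SqOp_mon (l : ℕ) (a : Expo) : SqOp 4 l (mon a) = sqAct l mon a := by
  rw [SqOp, (isHomogeneous_mon a).totalDegree (mon_ne_zero a), Finset.sum_eq_single (deg a)]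
  · rw [homogeneousComponent_mon, if_pos rfl, homogeneousComponent_SqTotal_mon]
  · intro d _ hd
    rw [homogeneousComponent_mon, if_neg hd.symm, map_zero, map_zero]
  · simp

lemma sqAct_mon_mem_hitSubmodule {l : ℕ} (hl : 0 < l) (a : Expo) : sqAct l mon a ∈ hitSubmodule 4 :=
  Submodule.subset_span ⟨l, mon a, hl, (SqOp_mon l a).symm⟩

/-- A function of exponents that is annihilated by all positive Steenrod squares. -/
def Annihilated (φ : Expo → ZMod 2) : Prop := ∀ l, 0 < l → ∀ a, sqAct l φ a = 0

/-- The linear functional on `P_4` with prescribed values on monomials. -/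
noncomputable def functional (φ : Expo → ZMod 2) : P4 →ₗ[ZMod 2] ZMod 2 :=
  (basisMonomials (Fin 4) (ZMod 2)).constr (ZMod 2) fun m => φ (m 0, m 1, m 2, m 3)

lemma functional_mon (φ : Expo → ZMod 2) (a : Expo) : functional φ (mon a) = φ a := by
  let m : Fin 4 →₀ ℕ := Finsupp.equivFunOnFinite.symm ![a.1, a.2.1, a.2.2.1, a.2.2.2]
  rw [mon_eq_monomial a m rfl rfl rfl rfl]
  exact (basisMonomials (Fin 4) (ZMod 2)).constr_basis (ZMod 2) _ m

lemma linearMap_ext_mon {N : Type*} [AddCommGroup N] [Module (ZMod 2) N] {f g : P4 →ₗ[ZMod 2] N}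
    (h : ∀ a, f (mon a) = g (mon a)) : f = g :=
  (basisMonomials (Fin 4) (ZMod 2)).ext fun m => by
    simp only [coe_basisMonomials, monomial_eq_mon, h]

lemma Annihilated.functional_eq_zero {φ : Expo → ZMod 2} (hφ : Annihilated φ) {f : P4}
    (hf : f ∈ hitSubmodule 4) : functional φ f = 0 := by
  refine (Submodule.span_le (p := LinearMap.ker (functional φ))).2 ?_ hf
  rintro _ ⟨l, f, hl, rfl⟩
  simp only [SqOp, SetLike.mem_coe, LinearMap.mem_ker, map_sum]
  refine Finset.sum_eq_zero fun d _ => ?_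
  have : (functional φ ∘ₗ homogeneousComponent (d + l) ∘ₗ (SqTotal 4).toLinearMap ∘ₗ
      homogeneousComponent d) = 0 := by
    refine linearMap_ext_mon fun a => ?_
    simp only [LinearMap.comp_apply, AlgHom.toLinearMap_apply, homogeneousComponent_mon,
      LinearMap.zero_apply]
    split_ifs with h
    · rw [← h, homogeneousComponent_SqTotal_mon, map_sqAct]
      simp only [functional_mon]
      exact hφ l hl a
    · simp only [map_zero]
  exact LinearMap.congr_fun this f

/-- The number of odd exponents. -/
def weight (a : Expo) : ℕ := a.1 % 2 + a.2.1 % 2 + a.2.2.1 % 2 + a.2.2.2 % 2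

/-- The parities of the exponents, encoded as a number below `16`. -/
def parityCode (a : Expo) : ℕ := a.1 % 2 + 2 * (a.2.1 % 2) + 4 * (a.2.2.1 % 2) + 8 * (a.2.2.2 % 2)

/-- Halve all exponents. -/
def half (a : Expo) : Expo := (a.1 / 2, a.2.1 / 2, a.2.2.1 / 2, a.2.2.2 / 2)

/-- The sequence of weights of the first `L` binary digits, encoded in base `5` with the lowest
digit being the most significant. -/
def weightKey : ℕ → Expo → ℕ
  | 0, _ => 0
  | L + 1, a => weight a * 5 ^ L + weightKey L (half a)

/-- The sequence of parity codes of the first `L` binary digits, in base `16`. -/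
def codeKey : ℕ → Expo → ℕ
  | 0, _ => 0
  | L + 1, a => parityCode a + 16 * codeKey L (half a)

/-- The order on monomials used for reductions. -/
def Lower (L : ℕ) (b a : Expo) : Prop :=
  weightKey L b < weightKey L a ∨ weightKey L b = weightKey L a ∧ codeKey L b < codeKey L a

instance (L : ℕ) (b a : Expo) : Decidable (Lower L b a) := by unfold Lower; infer_instance

lemma weight_le (a : Expo) : weight a ≤ 4 := by
  unfold weight; omega

lemma weightKey_lt (L : ℕ) (a : Expo) : weightKey L a < 5 ^ L := by
  induction L generalizing a with
  | zero => simp [weightKey]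
  | succ L ih =>
    have h1 := weight_le a
    have h2 := ih (half a)
    rw [weightKey, pow_succ]
    nlinarith

lemma half_add_two_nsmul {ε : Expo} (hε : ε ≤ (1, 1, 1, 1)) (a : Expo) : half (ε + 2 • a) = a := by
  obtain ⟨h₀, h₁, h₂, h₃⟩ := hε
  simp only at h₀ h₁ h₂ h₃
  simp only [half, Prod.fst_add, Prod.snd_add, Prod.smul_fst, Prod.smul_snd, smul_eq_mul]
  ext <;> simp only <;> omega

lemma weight_add_two_nsmul (ε a : Expo) : weight (ε + 2 • a) = weight ε := by
  simp only [weight, Prod.fst_add, Prod.snd_add, Prod.smul_fst, Prod.smul_snd, smul_eq_mul,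
    Nat.add_mul_mod_self_left]

lemma parityCode_add_two_nsmul (ε a : Expo) : parityCode (ε + 2 • a) = parityCode ε := by
  simp only [parityCode, Prod.fst_add, Prod.snd_add, Prod.smul_fst, Prod.smul_snd, smul_eq_mul,
    Nat.add_mul_mod_self_left]

lemma weightKey_lt_of_weight_lt {L : ℕ} {b a : Expo} (h : weight b < weight a) :
    weightKey (L + 1) b < weightKey (L + 1) a := by
  have h2 := weightKey_lt L (half b)
  rw [weightKey, weightKey]
  calc _ < (weight b + 1) * 5 ^ L := by rw [add_mul]; omega
    _ ≤ weight a * 5 ^ L := Nat.mul_le_mul_right _ h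
    _ ≤ _ := Nat.le_add_right _ _

/-- The span of the hit elements `Sq^l(x^h)` of the degree of `x^a` together with the monomials of
that degree that are lower than `x^a`. -/
noncomputable def reducedSpan (L : ℕ) (a : Expo) : Submodule (ZMod 2) P4 :=
  Submodule.span (ZMod 2) ({f | ∃ l h, 0 < l ∧ deg h + l = deg a ∧ f = sqAct l mon h} ∪
    {f | ∃ b, deg b = deg a ∧ Lower L b a ∧ f = mon b})

lemma sqAct_mem_reducedSpan {L l : ℕ} {a h : Expo} (hl : 0 < l) (hd : deg h + l = deg a) :
    sqAct l mon h ∈ reducedSpan L a :=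
  Submodule.subset_span (Or.inl ⟨l, h, hl, hd, rfl⟩)

lemma mon_mem_reducedSpan {L : ℕ} {a b : Expo} (hd : deg b = deg a) (hb : Lower L b a) :
    mon b ∈ reducedSpan L a :=
  Submodule.subset_span (Or.inr ⟨b, hd, hb, rfl⟩)

/-- Multiplication by `f` after squaring, which is linear over `F_2`. -/
noncomputable def mulSq (f : P4) : P4 →ₗ[ZMod 2] P4 where
  toFun g := f * g ^ 2
  map_add' g h := by rw [CharTwo.add_sq, mul_add]
  map_smul' c g := by
    rw [smul_pow, mul_smul_comm, RingHom.id_apply, ZMod.pow_card]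

lemma mulSq_mon (ε b : Expo) : mulSq (mon ε) (mon b) = mon (ε + 2 • b) := by
  rw [mon_add, mon_two_nsmul]
  rfl

lemma add_two_nsmul_add (ε h β b : Expo) :
    (ε + 2 • h) + (β + 2 • b) = (ε + β) + 2 • (h + b) := by
  rw [nsmul_add]; abel

lemma weight_add_lt {ε β : Expo} (hε : ε ≤ (1, 1, 1, 1)) (hβ : β ≤ ε) (h0 : β ≠ 0) :
    weight (ε + β) < weight ε := by
  obtain ⟨e₀, e₁, e₂, e₃⟩ := ε
  obtain ⟨β₀, β₁, β₂, β₃⟩ := β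
  simp only [Prod.mk_le_mk] at hε hβ
  simp only [ne_eq, Prod.mk_eq_zero] at h0
  simp only [weight, Prod.mk_add_mk]
  omega

lemma lower_add_two_nsmul {L : ℕ} {ε a b : Expo} (hε : ε ≤ (1, 1, 1, 1)) (h : Lower L b a) :
    Lower (L + 1) (ε + 2 • b) (ε + 2 • a) := by
  simp only [Lower, weightKey, codeKey, weight_add_two_nsmul, parityCode_add_two_nsmul,
    half_add_two_nsmul hε] at h ⊢
  omega

lemma mulSq_sqAct (ε h : Expo) (l : ℕ) : mulSq (mon ε) (sqAct l mon h) =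
    multiBinSum h fun b => if deg (0 + 2 • b) = 2 * l then mon (ε + 2 • h + (0 + 2 • b)) else 0 := by
  rw [map_sqAct]
  simp only [mulSq_mon, sqAct, zero_add, deg_nsmul, mul_right_inj' two_ne_zero, nsmul_add,
    add_assoc]

lemma mulSq_sqAct_mem_reducedSpan {L l : ℕ} {ε a h : Expo} (hε : ε ≤ (1, 1, 1, 1)) (hl : 0 < l)
    (hd : deg h + l = deg a) :
    mulSq (mon ε) (sqAct l mon h) ∈ reducedSpan (L + 1) (ε + 2 • a) := by
  have hdeg : deg (ε + 2 • h) + 2 * l = deg (ε + 2 • a) := by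
    simp only [deg_add, deg_nsmul, ← hd]; ring
  have h1 : sqAct (2 * l) mon (ε + 2 • h) ∈ reducedSpan (L + 1) (ε + 2 • a) :=
    sqAct_mem_reducedSpan (Nat.mul_pos two_pos hl) hdeg
  have h0 : (0 : Expo) ∈ Finset.Iic ε := Finset.mem_Iic.2 zero_le
  have h2 : ∀ β ∈ (Finset.Iic ε).erase 0, (multiBinSum h fun b => if deg (β + 2 • b) = 2 * l then
      mon (ε + 2 • h + (β + 2 • b)) else 0) ∈ reducedSpan (L + 1) (ε + 2 • a) := by
    intro β hβ
    refine multiBinSum_mem _ _ fun b => ?_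
    split_ifs with hb
    · refine mon_mem_reducedSpan (by rw [deg_add, hb, hdeg]) (Or.inl ?_)
      refine weightKey_lt_of_weight_lt ?_
      rw [add_two_nsmul_add, weight_add_two_nsmul, weight_add_two_nsmul]
      obtain ⟨hβ0, hβε⟩ := Finset.mem_erase.1 hβ
      exact weight_add_lt hε (Finset.mem_Iic.1 hβε) hβ0
    · exact Submodule.zero_mem _
  rw [sqAct, multiBinSum_add_two_nsmul hε, ← Finset.add_sum_erase _ _ h0, ← mulSq_sqAct] at h1
  exact (Submodule.add_mem_iff_left _ (Submodule.sum_mem _ h2)).1 h1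

lemma mon_mem_reducedSpan_succ {L : ℕ} {ε a : Expo} (hε : ε ≤ (1, 1, 1, 1))
    (ha : mon a ∈ reducedSpan L a) : mon (ε + 2 • a) ∈ reducedSpan (L + 1) (ε + 2 • a) := by
  suffices h : reducedSpan L a ≤ (reducedSpan (L + 1) (ε + 2 • a)).comap (mulSq (mon ε)) by
    rw [← mulSq_mon, ← Submodule.mem_comap]
    exact h ha
  refine Submodule.span_le.2 ?_
  rintro _ (⟨l, h, hl, hd, rfl⟩ | ⟨b, hd, hb, rfl⟩)
  · exact mulSq_sqAct_mem_reducedSpan hε hl hd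
  · rw [SetLike.mem_coe, Submodule.mem_comap, mulSq_mon]
    exact mon_mem_reducedSpan (by simp only [deg_add, deg_nsmul, hd]) (lower_add_two_nsmul hε hb)

section ListSums

variable {M α β : Type*} [AddCommGroup M]

lemma sum_map_flatMap (l : List β) (F : β → List α) (f : α → M) :
    ((l.flatMap F).map f).sum = (l.map fun b => ((F b).map f).sum).sum := by
  induction l with
  | nil => simp
  | cons b l ih => simp [ih]

variable [Module (ZMod 2) M]

lemma sum_map_mem_of_count [BEq α] [LawfulBEq α] (S : Submodule (ZMod 2) M) (f : α → M) (l : List α)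
    (h : ∀ x ∈ l, f x ∈ S ∨ 2 ∣ l.count x) : (l.map f).sum ∈ S := by
  classical
  rw [Finset.sum_list_map_count]
  refine S.sum_mem fun x hx => ?_
  rcases h x (List.mem_toFinset.1 hx) with h | h
  · exact S.nsmul_mem h _
  · have hc : @List.count α instBEqOfDecidableEq x l = l.count x := by
      congr 1
      exact lawful_beq_subsingleton _ _
    rw [hc, ← Nat.cast_smul_eq_nsmul (ZMod 2), (ZMod.natCast_eq_zero_iff _ _).2 h, zero_smul]
    exact S.zero_mem

/-- The list of all `β ≤ ε`. -/
def box (ε : Expo) : List Expo :=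
  (List.range (ε.1 + 1)).flatMap fun b₀ => (List.range (ε.2.1 + 1)).flatMap fun b₁ =>
    (List.range (ε.2.2.1 + 1)).flatMap fun b₂ => (List.range (ε.2.2.2 + 1)).map fun b₃ =>
      (b₀, b₁, b₂, b₃)

/-- The parities of the exponents. -/
def parity (a : Expo) : Expo := (a.1 % 2, a.2.1 % 2, a.2.2.1 % 2, a.2.2.2 % 2)

/-- The exponent `β + 2 b`, in a form suitable for evaluation. -/
def consBits (β b : Expo) : Expo :=
  (β.1 + 2 * b.1, β.2.1 + 2 * b.2.1, β.2.2.1 + 2 * b.2.2.1, β.2.2.2 + 2 * b.2.2.2)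

/-- The exponents `b` of degree `l` such that all `(h i).choose (b i)` are odd, for exponents `h`
less than `2 ^ n`. -/
def oddChoose : ℕ → ℕ → Expo → List Expo
  | 0, l, _ => bif l == 0 then [(0, 0, 0, 0)] else []
  | n + 1, l, h => (box (parity h)).flatMap fun β =>
      bif Nat.ble (deg β) l && (l - deg β) % 2 == 0 then
        (oddChoose n ((l - deg β) / 2) (half h)).map (consBits β)
      else []

lemma consBits_eq (β b : Expo) : consBits β b = β + 2 • b := rfl

lemma parity_le (a : Expo) : parity a ≤ (1, 1, 1, 1) := by
  simp only [parity, Prod.mk_le_mk]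
  omega

lemma parity_add_half (a : Expo) : parity a + 2 • half a = a := by
  simp only [parity, half, Prod.smul_mk, Prod.mk_add_mk, smul_eq_mul, Nat.mod_add_div]

/-- All exponents are less than `n`. -/
def AllLT (n : ℕ) (a : Expo) : Prop := a.1 < n ∧ a.2.1 < n ∧ a.2.2.1 < n ∧ a.2.2.2 < n

instance (n : ℕ) (a : Expo) : Decidable (AllLT n a) := by unfold AllLT; infer_instance

lemma AllLT.half {r : ℕ} {o : Expo} (ho : AllLT (2 ^ (r + 1)) o) : AllLT (2 ^ r) (half o) := by
  obtain ⟨h₀, h₁, h₂, h₃⟩ := ho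
  rw [pow_succ] at h₀ h₁ h₂ h₃
  refine ⟨?_, ?_, ?_, ?_⟩ <;> simp only [HitProblem.half] <;> omega

lemma AllLT.eq_zero {o : Expo} (ho : AllLT (2 ^ 0) o) : o = 0 := by
  obtain ⟨h₀, h₁, h₂, h₃⟩ := ho
  ext <;> simp_all

omit [Module (ZMod 2) M] in
lemma sum_map_box (ε : Expo) (f : Expo → M) : ((box ε).map f).sum = ∑ β ∈ Finset.Iic ε, f β := by
  obtain ⟨e₀, e₁, e₂, e₃⟩ := ε
  simp only [box, Iic_prod, Finset.sum_product, ← Nat.range_succ_eq_Iic, sum_map_flatMap,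
    List.map_map]
  rfl

lemma deg_of_mem_oddChoose {n l : ℕ} {h b : Expo} (hb : b ∈ oddChoose n l h) : deg b = l := by
  induction n generalizing l h b with
  | zero =>
    rcases eq_or_ne l 0 with rfl | hl
    · simp_all [oddChoose, deg]
    · simp [oddChoose, beq_eq_false_iff_ne.2 hl] at hb
  | succ n ih =>
    rw [oddChoose, List.mem_flatMap] at hb
    obtain ⟨β, -, hb⟩ := hb
    rw [Bool.cond_eq_ite] at hb
    simp only [Bool.and_eq_true, Nat.ble_eq, beq_iff_eq] at hb
    split_ifs at hb with hβ
    · obtain ⟨c, hc, rfl⟩ := List.mem_map.1 hb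
      rw [consBits_eq, deg_add, deg_nsmul, ih hc]
      omega
    · simp at hb

lemma multiBinSum_eq_sum_oddChoose (n l : ℕ) {h : Expo} (hh : AllLT (2 ^ n) h) (Φ : Expo → M) :
    multiBinSum h (fun b => if deg b = l then Φ b else 0) = ((oddChoose n l h).map Φ).sum := by
  induction n generalizing l h Φ with
  | zero =>
    obtain rfl := hh.eq_zero
    rw [multiBinSum_zero_left, oddChoose]
    rcases eq_or_ne l 0 with rfl | hl
    · simp only [deg, Prod.fst_zero, Prod.snd_zero, add_zero, if_true, beq_self_eq_true, cond_true,
        List.map_cons, List.map_nil, List.sum_cons, List.sum_nil]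
      rfl
    · simp [deg, beq_eq_false_iff_ne.2 hl, hl.symm]
  | succ n ih =>
    rw [oddChoose, sum_map_flatMap, sum_map_box]
    conv_lhs => rw [← parity_add_half h]
    rw [multiBinSum_add_two_nsmul (parity_le h)]
    refine Finset.sum_congr rfl fun β _ => ?_
    simp only [deg_add, deg_nsmul]
    by_cases hβ : deg β ≤ l ∧ (l - deg β) % 2 = 0
    · have h1 : ∀ b, deg β + 2 * deg b = l ↔ deg b = (l - deg β) / 2 := by intro b; omega
      rw [show (Nat.ble (deg β) l && (l - deg β) % 2 == 0) = true by
        simpa only [Bool.and_eq_true, Nat.ble_eq, beq_iff_eq] using hβ]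
      simp only [h1, ih _ hh.half, cond_true, List.map_map]
      rfl
    · have h1 : ∀ b, ¬ (deg β + 2 * deg b = l) := by intro b; omega
      rw [show (Nat.ble (deg β) l && (l - deg β) % 2 == 0) = false by
        rw [← Bool.not_eq_true]; simpa only [Bool.and_eq_true, Nat.ble_eq, beq_iff_eq] using hβ]
      simp only [h1, if_false, multiBinSum_zero, cond_false, List.map_nil, List.sum_nil]

end ListSums

/-- The exponent whose parities are given by the binary digits of `c`. -/
def bits (c : ℕ) : Expo := (c % 2, c / 2 % 2, c / 4 % 2, c / 8 % 2)

/-- The exponent with the given sequence of parity codes, starting from the lowest digit. -/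
def toExpo : List ℕ → Expo
  | [] => 0
  | c :: w => bits c + 2 • toExpo w

lemma bits_le (c : ℕ) : bits c ≤ (1, 1, 1, 1) := by
  simp only [bits, Prod.mk_le_mk]
  omega

lemma toExpo_append (u v : List ℕ) :
    toExpo (u ++ v) = toExpo u + 2 ^ u.length • toExpo v := by
  induction u with
  | nil => simp [toExpo]
  | cons c u ih =>
    simp only [List.cons_append, toExpo, ih, List.length_cons, nsmul_add, smul_smul, pow_succ']
    abel

lemma half_add_two_pow_nsmul (r : ℕ) (o y : Expo) :
    half (o + 2 ^ (r + 1) • y) = half o + 2 ^ r • y := by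
  simp only [half, pow_succ', Prod.fst_add, Prod.snd_add, Prod.smul_fst, Prod.smul_snd, smul_eq_mul,
    mul_assoc]
  ext <;> simp only [Prod.fst_add, Prod.snd_add, Prod.smul_fst, Prod.smul_snd, smul_eq_mul] <;> omega

lemma weight_add_two_pow_nsmul (r : ℕ) (o y : Expo) : weight (o + 2 ^ (r + 1) • y) = weight o := by
  rw [pow_succ', mul_smul, weight_add_two_nsmul]

lemma parityCode_add_two_pow_nsmul (r : ℕ) (o y : Expo) :
    parityCode (o + 2 ^ (r + 1) • y) = parityCode o := by
  rw [pow_succ', mul_smul, parityCode_add_two_nsmul]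

lemma exists_weightKey_add (r k : ℕ) (o y : Expo) :
    ∃ z < 5 ^ k, weightKey (r + k) (o + 2 ^ r • y) = weightKey r o * 5 ^ k + z := by
  induction r generalizing o with
  | zero => exact ⟨weightKey k (o + 1 • y), weightKey_lt k _, by simp [weightKey]⟩
  | succ r ih =>
    obtain ⟨z, hz, h⟩ := ih (half o)
    refine ⟨z, hz, ?_⟩
    rw [Nat.add_right_comm, weightKey, half_add_two_pow_nsmul, h, weight_add_two_pow_nsmul,
      weightKey, pow_add]
    ring

lemma weightKey_add {r : ℕ} (k : ℕ) {o : Expo} (ho : AllLT (2 ^ r) o) (y : Expo) :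
    weightKey (r + k) (o + 2 ^ r • y) = weightKey r o * 5 ^ k + weightKey k y := by
  induction r generalizing o with
  | zero => simp [ho.eq_zero, weightKey]
  | succ r ih =>
    rw [Nat.add_right_comm, weightKey, half_add_two_pow_nsmul, ih ho.half,
      weight_add_two_pow_nsmul, weightKey, pow_add]
    ring

lemma codeKey_add {r : ℕ} (k : ℕ) {o : Expo} (ho : AllLT (2 ^ r) o) (y : Expo) :
    codeKey (r + k) (o + 2 ^ r • y) = codeKey r o + 16 ^ r * codeKey k y := by
  induction r generalizing o with
  | zero => simp [ho.eq_zero, codeKey]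
  | succ r ih =>
    rw [Nat.add_right_comm, codeKey, half_add_two_pow_nsmul, ih ho.half,
      parityCode_add_two_pow_nsmul, codeKey, pow_succ]
    ring

/-- Exponents `o` for which `o + 2 ^ r • y` is lower than `p + 2 ^ r • y` for all `y`. -/
def LowerHead (r : ℕ) (o p : Expo) : Prop :=
  weightKey r o < weightKey r p ∨
    weightKey r o = weightKey r p ∧ codeKey r o < codeKey r p ∧ AllLT (2 ^ r) o

instance (r : ℕ) (o p : Expo) : Decidable (LowerHead r o p) := by unfold LowerHead; infer_instance

lemma LowerHead.lower {r : ℕ} {o p : Expo} (h : LowerHead r o p) (hp : AllLT (2 ^ r) p) (k : ℕ)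
    (y : Expo) : Lower (r + k) (o + 2 ^ r • y) (p + 2 ^ r • y) := by
  rw [Lower, weightKey_add k hp, codeKey_add k hp]
  rcases h with h | ⟨h1, h2, ho⟩
  · obtain ⟨z, hz, hzo⟩ := exists_weightKey_add r k o y
    left
    calc _ < (weightKey r o + 1) * 5 ^ k := by rw [hzo, add_mul]; omega
      _ ≤ weightKey r p * 5 ^ k := Nat.mul_le_mul_right _ h
      _ ≤ _ := Nat.le_add_right _ _
  · rw [weightKey_add k ho, codeKey_add k ho, h1]
    exact Or.inr ⟨rfl, by omega⟩

/-- The exponents occurring in the sum of the `Sq^l(x^h)` over all pairs `(l, h)` in a list. -/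
def certTerms (r : ℕ) (cert : List (ℕ × Expo)) : List Expo :=
  cert.flatMap fun e => (oddChoose r e.1 e.2).map (e.2 + ·)

/-- Every element of the list occurs an even number of times. -/
def evenCounts (l : List Expo) : Bool := l.all fun x => l.count x % 2 == 0

/-- A certificate showing that a monomial with leading word `w` reduces to lower monomials. -/
def ValidRule (w : List ℕ) (cert : List (ℕ × Expo)) : Prop :=
  AllLT (2 ^ w.length) (toExpo w) ∧
  (∀ e ∈ cert, 0 < e.1 ∧ e.1 < 2 ^ w.length ∧ AllLT (2 ^ w.length) e.2 ∧
    deg e.2 + e.1 = deg (toExpo w)) ∧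
  evenCounts ((toExpo w :: certTerms w.length cert).filter
    fun x => !decide (LowerHead w.length x (toExpo w))) = true

instance (w : List ℕ) (cert : List (ℕ × Expo)) : Decidable (ValidRule w cert) := by
  unfold ValidRule; infer_instance

lemma sqAct_mon_add {r l : ℕ} (hl : l < 2 ^ r) {h : Expo} (hh : AllLT (2 ^ r) h) (y : Expo) :
    sqAct l mon (h + 2 ^ r • y) =
      (((oddChoose r l h).map (h + ·)).map fun o => mon (o + 2 ^ r • y)).sum := by
  rw [sqAct, multiBinSum_add_two_pow_nsmul r (by simpa [AllLT] using hh) y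
    (fun b hb => if_neg (by omega)), multiBinSum_eq_sum_oddChoose r l hh, List.map_map]
  simp only [Function.comp_def, add_right_comm]

lemma ValidRule.mon_mem {w : List ℕ} {cert : List (ℕ × Expo)} (hw : ValidRule w cert) (v : List ℕ) :
    mon (toExpo (w ++ v)) ∈ reducedSpan (w ++ v).length (toExpo (w ++ v)) := by
  obtain ⟨hp, hc, he⟩ := hw
  rw [toExpo_append, List.length_append]
  set y := toExpo v
  set S := reducedSpan (w.length + v.length) (toExpo w + 2 ^ w.length • y)
  set f : Expo → P4 := fun o => mon (o + 2 ^ w.length • y) with hf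
  have h1 : ((toExpo w :: certTerms w.length cert).map f).sum ∈ S := by
    refine sum_map_mem_of_count _ _ _ fun x hx => ?_
    by_cases hlow : LowerHead w.length x (toExpo w)
    · refine Or.inl (mon_mem_reducedSpan ?_ (hlow.lower hp _ _))
      rw [deg_add, deg_add]
      congr 1
      rcases List.mem_cons.1 hx with rfl | hx
      · rfl
      · simp only [certTerms, List.mem_flatMap, List.mem_map] at hx
        obtain ⟨e, he, b, hb, rfl⟩ := hx
        rw [deg_add, deg_of_mem_oddChoose hb, (hc e he).2.2.2]
    · right
      rw [evenCounts, List.all_eq_true] at he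
      have := he x (List.mem_filter.2 ⟨hx, by simp [hlow]⟩)
      rw [List.count_filter (by simp [hlow])] at this
      exact Nat.dvd_of_mod_eq_zero (by simpa using this)
  have h2 : ((certTerms w.length cert).map f).sum ∈ S := by
    rw [certTerms, sum_map_flatMap]
    refine list_sum_mem fun g hg => ?_
    obtain ⟨e, he, rfl⟩ := List.mem_map.1 hg
    obtain ⟨h0, h1, h2, h3⟩ := hc e he
    rw [hf, ← sqAct_mon_add h1 h2]
    exact sqAct_mem_reducedSpan h0 (by rw [deg_add, deg_add, ← h3]; ring)
  rw [List.map_cons, List.sum_cons] at h1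
  exact (Submodule.add_mem_iff_left _ h2).1 h1

/-- Leading words of reducible monomials together with certificates. -/
def rules : List (List ℕ × List (ℕ × Expo)) := [
  ([0,2], [(1, 0, 1, 0, 0)]),
  ([0,8], [(1, 0, 0, 0, 1)]),
  ([0,4], [(1, 0, 0, 1, 0)]),
  ([0,1], [(1, 1, 0, 0, 0)]),
  ([0,3], [(1, 2, 1, 0, 0)]),
  ([0,9], [(1, 2, 0, 0, 1)]),
  ([0,12], [(1, 0, 0, 1, 2)]),
  ([0,5], [(2, 1, 0, 1, 0)]),
  ([0,10], [(1, 0, 1, 0, 2)]),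
  ([0,6], [(1, 0, 1, 2, 0)]),
  ([0,14], [(1, 0, 2, 1, 2)]),
  ([0,7], [(1, 2, 1, 2, 0)]),
  ([0,11], [(1, 2, 1, 0, 2)]),
  ([0,13], [(1, 1, 0, 2, 2)]),
  ([0,15], [(1, 2, 2, 1, 2)]),
  ([10,15], [(1, 1, 3, 2, 3)]),
  ([5,15], [(1, 3, 2, 3, 1)]),
  ([9,15], [(1, 3, 2, 1, 3)]),
  ([6,15], [(1, 2, 3, 3, 1)]),
  ([3,15], [(1, 3, 3, 1, 2)]),
  ([12,15], [(1, 2, 1, 3, 3)]),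
  ([11,15], [(1, 3, 3, 1, 3)]),
  ([14,15], [(1, 1, 3, 3, 3)]),
  ([13,15], [(1, 3, 1, 3, 3)]),
  ([7,15], [(1, 3, 3, 3, 1)]),
  ([1,4], [(1, 1, 0, 1, 0)]),
  ([2,4], [(1, 0, 1, 1, 0)]),
  ([2,8], [(1, 0, 1, 0, 1)]),
  ([4,8], [(1, 0, 0, 1, 1)]),
  ([1,2], [(1, 1, 1, 0, 0)]),
  ([1,8], [(1, 1, 0, 0, 1)]),
  ([4,14], [(1, 0, 2, 3, 1)]),
  ([8,11], [(1, 2, 1, 0, 3)]),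
  ([2,14], [(1, 0, 3, 2, 1)]),
  ([8,14], [(1, 0, 1, 2, 3)]),
  ([4,13], [(1, 1, 0, 3, 2)]),
  ([1,11], [(1, 3, 1, 0, 2)]),
  ([1,7], [(1, 3, 2, 1, 0)]),
  ([2,7], [(1, 1, 3, 2, 0)]),
  ([4,7], [(1, 2, 1, 3, 0)]),
  ([1,13], [(1, 3, 0, 2, 1)]),
  ([8,13], [(1, 1, 0, 2, 3)]),
  ([2,11], [(1, 2, 3, 0, 1)]),
  ([1,14], [(1, 1, 2, 1, 2)]),
  ([2,13], [(1, 2, 1, 1, 2)]),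
  ([4,11], [(1, 2, 2, 1, 1)]),
  ([6,10], [(1, 0, 3, 1, 1)]),
  ([3,9], [(1, 3, 1, 0, 1)]),
  ([9,12], [(1, 1, 0, 1, 3)]),
  ([3,10], [(1, 1, 3, 0, 1)]),
  ([6,12], [(1, 0, 1, 3, 1)]),
  ([9,10], [(1, 1, 1, 0, 3)]),
  ([3,6], [(1, 1, 3, 1, 0)]),
  ([3,5], [(1, 3, 1, 1, 0)]),
  ([5,6], [(1, 1, 1, 3, 0)]),
  ([5,12], [(1, 1, 0, 3, 1)]),
  ([10,12], [(1, 0, 1, 1, 3)]),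
  ([5,9], [(1, 3, 0, 1, 1)]),
  ([5,10], [(1, 1, 2, 1, 1)]),
  ([3,12], [(1, 1, 1, 1, 2)]),
  ([6,9], [(1, 2, 1, 1, 1)]),
  ([9,6], [(1, 1, 1, 1, 2), (2, 1, 1, 1, 1)]),
  ([7,10], [(1, 1, 3, 1, 1)]),
  ([11,12], [(1, 1, 1, 1, 3)]),
  ([7,12], [(1, 1, 1, 3, 1)]),
  ([7,9], [(1, 3, 1, 1, 1)]),
  ([8,8,1], [(1, 3, 0, 0, 3), (2, 3, 0, 0, 2)]),
  ([2,2,1], [(1, 3, 3, 0, 0), (2, 3, 2, 0, 0)]),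
  ([4,4,2], [(1, 0, 3, 3, 0), (2, 0, 3, 2, 0)]),
  ([8,8,2], [(1, 0, 3, 0, 3), (2, 0, 3, 0, 2)]),
  ([4,4,1], [(1, 3, 0, 3, 0), (2, 3, 0, 2, 0)]),
  ([8,8,4], [(1, 0, 0, 3, 3), (2, 0, 0, 3, 2)]),
  ([8,7,5], [(1, 5, 2, 3, 4), (1, 6, 2, 5, 1), (2, 6, 2, 3, 2)]),
  ([8,7,6], [(1, 2, 5, 3, 4), (1, 2, 6, 5, 1), (2, 2, 6, 3, 2)]),
  ([8,7,3], [(1, 5, 3, 4, 2), (1, 6, 3, 1, 4), (1, 6, 5, 2, 1), (2, 6, 3, 2, 2)]),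
  ([8,8,7], [(1, 3, 4, 4, 3), (2, 3, 4, 4, 2)]),
  ([9,9,5], [(1, 7, 0, 3, 3), (2, 7, 0, 3, 2)]),
  ([10,10,3], [(1, 3, 7, 0, 3), (2, 3, 7, 0, 2)]),
  ([12,12,6], [(1, 0, 3, 7, 3), (2, 0, 3, 7, 2)]),
  ([6,6,5], [(1, 3, 3, 7, 0), (2, 3, 2, 7, 0)]),
  ([10,10,9], [(1, 3, 3, 0, 7), (2, 3, 2, 0, 7)]),
  ([5,5,3], [(1, 7, 3, 3, 0), (2, 7, 3, 2, 0)]),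
  ([12,12,10], [(1, 0, 3, 3, 7), (2, 0, 3, 2, 7)]),
  ([12,12,9], [(1, 3, 0, 3, 7), (2, 3, 0, 2, 7)]),
  ([12,12,5], [(1, 3, 0, 7, 3), (2, 3, 0, 7, 2)]),
  ([6,6,3], [(1, 3, 7, 3, 0), (2, 3, 7, 2, 0)]),
  ([10,10,6], [(1, 0, 7, 3, 3), (2, 0, 7, 3, 2)]),
  ([9,9,3], [(1, 7, 3, 0, 3), (2, 7, 3, 0, 2)]),
  ([10,10,5], [(1, 4, 3, 3, 3), (2, 4, 3, 3, 2)]),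
  ([10,9,5], [(1, 3, 3, 4, 3), (1, 3, 5, 4, 1), (1, 4, 3, 3, 3), (1, 4, 3, 5, 1), (1, 5, 1, 4,
    3), (1, 5, 3, 4, 1), (2, 3, 2, 2, 5), (2, 3, 3, 4, 2), (2, 3, 6, 2, 1), (2, 4, 3, 3, 2), (4,
    3, 2, 2, 3)]),
  ([10,6,5], [(1, 3, 3, 3, 4), (1, 3, 4, 5, 1), (1, 3, 5, 4, 1), (1, 4, 3, 5, 1), (1, 5, 3, 4,
    1), (2, 3, 2, 6, 1), (2, 3, 3, 4, 2), (2, 3, 4, 3, 2), (2, 3, 6, 2, 1), (2, 4, 3, 3, 2)]),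
  ([12,10,9,3], [(1, 5, 5, 8, 11), (1, 5, 9, 4, 11), (1, 5, 9, 8, 7), (1, 8, 9, 5, 7), (1, 8,
    11, 3, 7), (1, 8, 13, 1, 7), (1, 9, 5, 4, 11), (1, 9, 5, 8, 7), (1, 9, 9, 4, 7), (1, 11, 3,
    7, 8), (1, 11, 3, 8, 7), (1, 12, 3, 11, 3), (1, 12, 9, 1, 7), (1, 13, 1, 7, 8), (1, 13, 1,
    8, 7), (1, 14, 1, 9, 5), (2, 6, 9, 6, 7), (2, 6, 9, 10, 3), (2, 6, 14, 1, 7), (2, 8, 10, 3,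
    7), (2, 8, 11, 2, 7), (2, 10, 3, 8, 7), (2, 10, 3, 12, 3), (2, 10, 5, 10, 3), (2, 10, 9, 2,
    7), (2, 10, 9, 6, 3), (2, 10, 14, 1, 3), (2, 11, 2, 7, 8), (2, 11, 2, 8, 7), (2, 12, 3, 10,
    3), (2, 14, 1, 6, 7), (2, 14, 1, 7, 6), (2, 14, 2, 9, 3), (4, 6, 5, 4, 11), (4, 6, 5, 12,
    3), (4, 6, 9, 6, 5), (4, 6, 14, 1, 5), (4, 10, 3, 10, 3), (4, 12, 3, 7, 4), (4, 12, 4, 7,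
    3), (4, 12, 5, 6, 3), (4, 14, 1, 6, 5), (4, 14, 4, 5, 3), (8, 5, 6, 4, 7)]),
  ([12,9,5,3], [(1, 11, 3, 7, 8), (1, 11, 3, 8, 7), (1, 11, 8, 3, 7), (1, 11, 8, 7, 3), (1, 12,
    3, 3, 11), (1, 12, 3, 9, 5), (1, 12, 3, 11, 3), (1, 12, 9, 3, 5), (1, 12, 9, 5, 3), (1, 13,
    1, 7, 8), (1, 13, 1, 8, 7), (1, 13, 8, 1, 7), (1, 13, 8, 7, 1), (1, 14, 1, 9, 5), (2, 11, 2,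
    7, 8), (2, 11, 2, 8, 7), (2, 11, 8, 2, 7), (2, 11, 8, 7, 2), (2, 12, 3, 3, 10), (2, 12, 3,
    10, 3), (2, 12, 10, 3, 3), (2, 14, 1, 6, 7), (2, 14, 1, 7, 6), (2, 14, 2, 9, 3), (2, 14, 6,
    1, 7), (2, 14, 10, 1, 3), (4, 12, 3, 4, 7), (4, 12, 3, 5, 6), (4, 12, 3, 7, 4), (4, 12, 4,
    3, 7), (4, 12, 4, 7, 3), (4, 12, 5, 3, 6), (4, 12, 5, 6, 3), (4, 14, 1, 6, 5), (4, 14, 4, 5,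
    3), (4, 14, 6, 1, 5)]),
  ([12,10,6,3], [(1, 8, 7, 11, 3), (1, 8, 7, 13, 1), (1, 8, 13, 5, 3), (1, 10, 5, 9, 5), (1, 12,
    3, 9, 5), (1, 12, 3, 11, 3), (1, 12, 3, 13, 1), (1, 12, 5, 11, 1), (2, 6, 7, 8, 7), (2, 6,
    7, 14, 1), (2, 6, 9, 6, 7), (2, 6, 9, 10, 3), (2, 6, 11, 2, 9), (2, 8, 7, 6, 7), (2, 8, 7,
    10, 3), (2, 8, 7, 11, 2), (2, 8, 11, 6, 3), (2, 10, 3, 9, 6), (2, 10, 3, 10, 5), (2, 10, 3,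
    12, 3), (2, 10, 3, 14, 1), (2, 10, 6, 9, 3), (2, 10, 7, 2, 9), (2, 10, 9, 6, 3), (2, 10, 13,
    2, 3), (2, 12, 3, 11, 2), (2, 12, 11, 2, 3), (4, 6, 5, 12, 3), (4, 6, 5, 14, 1), (4, 6, 7,
    4, 9), (4, 6, 9, 6, 5), (4, 6, 13, 2, 5), (4, 8, 7, 6, 5), (4, 12, 4, 7, 3), (4, 12, 6, 5,
    3), (4, 12, 6, 7, 1), (4, 12, 7, 2, 5)]),
  ([12,12,3,3], [(1, 11, 7, 3, 8), (1, 11, 7, 8, 3), (1, 12, 11, 3, 3), (1, 13, 7, 1, 8), (1,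
    13, 11, 4, 1), (2, 11, 7, 2, 8), (2, 11, 7, 8, 2), (2, 14, 11, 1, 2), (2, 14, 11, 2, 1), (4,
    12, 7, 3, 4), (4, 12, 7, 4, 3), (4, 13, 7, 4, 2), (4, 14, 7, 1, 4)]),
  ([12,6,5,3], [(1, 6, 9, 9, 5), (1, 8, 9, 7, 5), (1, 8, 11, 7, 3), (1, 8, 13, 7, 1), (1, 11, 8,
    7, 3), (1, 12, 3, 11, 3), (1, 12, 9, 5, 3), (1, 12, 9, 7, 1), (1, 13, 8, 7, 1), (2, 6, 9, 7,
    6), (2, 6, 9, 10, 3), (2, 6, 10, 9, 3), (2, 6, 14, 7, 1), (2, 8, 10, 7, 3), (2, 8, 11, 7,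
    2), (2, 10, 3, 7, 8), (2, 10, 3, 12, 3), (2, 10, 5, 10, 3), (2, 10, 9, 7, 2), (2, 10, 10, 3,
    5), (2, 10, 14, 3, 1), (2, 11, 8, 7, 2), (2, 12, 3, 10, 3), (4, 6, 5, 11, 4), (4, 6, 5, 12,
    3), (4, 6, 12, 5, 3), (4, 6, 14, 5, 1), (4, 10, 3, 10, 3), (4, 10, 10, 3, 3), (4, 12, 3, 7,
    4), (4, 12, 4, 7, 3), (4, 12, 5, 6, 3), (8, 6, 5, 7, 4)]),
  ([12,12,12,3], [(1, 8, 7, 7, 7), (1, 8, 7, 11, 3), (2, 8, 7, 6, 7), (2, 8, 7, 10, 3), (4, 8,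
    7, 6, 5), (4, 8, 7, 7, 4)]),
  ([13,12,10,10], [(1, 1, 9, 5, 15), (2, 1, 7, 6, 15), (2, 1, 10, 3, 15), (2, 1, 11, 2, 15), (2,
    2, 9, 3, 15), (4, 1, 7, 4, 15)]),
  ([13,12,6,6], [(1, 1, 9, 15, 5), (2, 1, 7, 15, 6), (2, 1, 10, 15, 3), (2, 1, 11, 15, 2), (2,
    2, 9, 15, 3), (4, 1, 7, 15, 4)]),
  ([14,10,6,3], [(1, 9, 15, 3, 3), (2, 6, 15, 3, 5), (2, 9, 15, 3, 2), (2, 10, 11, 3, 5), (4, 6,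
    15, 3, 3), (8, 6, 11, 3, 3)]),
  ([13,12,10,9], [(1, 9, 1, 5, 15), (2, 7, 1, 6, 15), (2, 9, 2, 3, 15), (2, 10, 1, 3, 15), (2,
    11, 1, 2, 15), (4, 7, 1, 4, 15)]),
  ([13,12,6,3], [(1, 11, 9, 7, 3), (2, 7, 10, 7, 5), (2, 11, 6, 9, 3), (2, 11, 8, 7, 3), (2, 11,
    9, 7, 2), (2, 13, 6, 7, 3), (4, 7, 6, 11, 3), (4, 7, 12, 5, 3), (4, 13, 6, 5, 3), (8, 7, 6,
    7, 3)]),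
  ([11,10,6,6], [(1, 1, 15, 9, 5), (2, 1, 15, 7, 6), (2, 1, 15, 10, 3), (2, 1, 15, 11, 2), (2,
    2, 15, 9, 3), (4, 1, 15, 7, 4)]),
  ([11,10,5,5], [(1, 13, 3, 11, 3), (2, 13, 3, 11, 2), (2, 14, 3, 9, 3), (2, 14, 5, 7, 3), (4,
    10, 3, 11, 3), (4, 14, 3, 7, 3), (8, 10, 3, 7, 3)]),
  ([11,9,5,5], [(1, 15, 1, 9, 5), (2, 15, 1, 7, 6), (2, 15, 1, 10, 3), (2, 15, 1, 11, 2), (2,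
    15, 2, 9, 3), (4, 15, 1, 7, 4)]),
  ([13,9,5,3], [(1, 15, 9, 3, 3), (2, 15, 6, 5, 3), (2, 15, 8, 3, 3), (2, 15, 9, 3, 2), (4, 11,
    10, 3, 3), (4, 15, 6, 3, 3), (8, 11, 6, 3, 3)]),
  ([13,12,6,5], [(1, 9, 1, 15, 5), (2, 7, 1, 15, 6), (2, 9, 2, 15, 3), (2, 10, 1, 15, 3), (2,
    11, 1, 15, 2), (4, 7, 1, 15, 4)]),
  ([14,12,10,5], [(1, 5, 3, 11, 11), (1, 9, 3, 11, 7), (2, 6, 3, 13, 7), (2, 6, 9, 11, 3), (2,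
    9, 3, 7, 10), (2, 10, 3, 7, 9), (4, 5, 3, 7, 12), (4, 5, 3, 12, 7), (4, 5, 8, 7, 7), (4, 6,
    3, 11, 7), (4, 6, 5, 7, 9), (4, 6, 5, 13, 3), (4, 6, 9, 7, 5), (4, 9, 4, 7, 7), (4, 9, 5, 7,
    6), (4, 12, 3, 7, 5), (8, 5, 4, 7, 7)]),
  ([11,9,5,3], [(1, 15, 9, 1, 5), (2, 15, 7, 1, 6), (2, 15, 9, 2, 3), (2, 15, 10, 1, 3), (2, 15,
    11, 1, 2), (4, 15, 7, 1, 4)]),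
  ([13,12,10,5], [(1, 9, 1, 13, 7), (2, 7, 1, 14, 7), (2, 9, 2, 11, 7), (2, 10, 1, 11, 7), (2,
    11, 1, 14, 3), (4, 7, 1, 14, 5)]),
  ([13,12,10,6], [(1, 1, 9, 13, 7), (2, 1, 7, 14, 7), (2, 1, 10, 11, 7), (2, 1, 11, 14, 3), (2,
    2, 9, 11, 7), (4, 1, 7, 14, 5)]),
  ([13,12,10,3], [(1, 9, 9, 5, 7), (1, 13, 5, 5, 7), (2, 7, 9, 2, 11), (2, 7, 9, 6, 7), (2, 7,
    9, 10, 3), (2, 9, 10, 3, 7), (2, 10, 9, 3, 7), (2, 11, 3, 6, 9), (2, 11, 3, 8, 7), (2, 11,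
    5, 2, 11), (2, 11, 5, 10, 3), (2, 11, 6, 3, 9), (2, 11, 6, 5, 7), (2, 11, 8, 3, 7), (2, 13,
    3, 6, 7), (2, 14, 5, 3, 7), (4, 7, 5, 2, 13), (4, 7, 5, 4, 11), (4, 7, 5, 8, 7), (4, 7, 5,
    12, 3), (4, 7, 9, 6, 5), (4, 11, 5, 6, 5), (4, 13, 5, 2, 7), (4, 13, 5, 6, 3), (4, 13, 6, 3,
    5), (4, 14, 5, 3, 5)]),
  ([14,12,10,3], [(1, 5, 11, 3, 11), (1, 9, 7, 3, 11), (2, 6, 7, 3, 13), (2, 6, 7, 7, 9), (2, 6,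
    9, 7, 7), (2, 6, 11, 9, 3), (2, 8, 7, 7, 7), (2, 8, 11, 3, 7), (2, 9, 11, 2, 7), (2, 10, 7,
    9, 3), (2, 10, 9, 3, 7), (4, 5, 7, 3, 12), (4, 5, 7, 8, 7), (4, 5, 12, 3, 7), (4, 6, 7, 3,
    11), (4, 6, 7, 9, 5), (4, 6, 9, 5, 7), (4, 6, 13, 5, 3), (4, 8, 7, 5, 7), (4, 12, 7, 5, 3),
    (8, 5, 7, 4, 7)]),
  ([11,10,5,3], [(1, 13, 11, 3, 3), (2, 13, 11, 3, 2), (2, 14, 7, 3, 5), (4, 10, 11, 3, 3), (4,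
    14, 7, 3, 3), (8, 10, 7, 3, 3)]),
  ([14,12,6,3], [(1, 5, 11, 11, 3), (1, 9, 7, 11, 3), (2, 5, 11, 11, 2), (2, 6, 7, 7, 9), (2, 6,
    7, 11, 5), (2, 6, 9, 11, 3), (2, 6, 11, 9, 3), (2, 8, 7, 11, 3), (2, 8, 11, 7, 3), (2, 9, 7,
    11, 2), (2, 10, 7, 9, 3), (2, 10, 9, 7, 3), (4, 5, 7, 12, 3), (4, 5, 7, 13, 2), (4, 5, 12,
    7, 3), (4, 5, 13, 7, 2), (4, 6, 7, 9, 5), (4, 6, 7, 11, 3), (4, 6, 9, 7, 5), (4, 6, 13, 5,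
    3), (4, 8, 7, 7, 5), (4, 12, 7, 5, 3)]),
  ([11,10,6,3], [(1, 9, 15, 1, 5), (2, 7, 15, 1, 6), (2, 9, 15, 2, 3), (2, 10, 15, 1, 3), (2,
    11, 15, 1, 2), (4, 7, 15, 1, 4)]),
  ([13,10,6,3], [(1, 11, 13, 3, 3), (2, 7, 14, 3, 5), (2, 11, 10, 5, 3), (2, 11, 12, 3, 3), (2,
    11, 13, 3, 2), (2, 13, 10, 3, 3), (4, 7, 14, 3, 3), (8, 7, 10, 3, 3)]),
  ([14,12,6,5], [(1, 9, 3, 15, 3), (2, 6, 5, 15, 3), (2, 8, 3, 15, 3), (2, 9, 3, 15, 2), (2, 10,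
    3, 11, 5), (4, 6, 3, 15, 3), (8, 6, 3, 11, 3)]),
  ([14,12,10,9], [(1, 9, 3, 3, 15), (2, 6, 5, 3, 15), (2, 8, 3, 3, 15), (2, 9, 3, 2, 15), (2,
    10, 3, 5, 11), (4, 6, 3, 3, 15), (8, 6, 3, 3, 11)]),
  ([13,12,9,3,3], [(1, 23, 9, 5, 25), (1, 25, 7, 5, 25), (1, 25, 21, 3, 13), (1, 25, 21, 5, 11),
    (1, 25, 21, 9, 7), (2, 15, 17, 3, 26), (2, 15, 23, 6, 17), (2, 15, 23, 16, 7), (2, 19, 7, 9,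
    26), (2, 19, 11, 3, 28), (2, 19, 11, 9, 22), (2, 19, 11, 17, 14), (2, 19, 19, 9, 14), (2,
    23, 7, 16, 15), (2, 23, 9, 6, 23), (2, 23, 10, 3, 25), (2, 23, 14, 17, 7), (2, 23, 25, 6,
    7), (2, 23, 27, 8, 3), (2, 25, 7, 3, 26), (2, 25, 7, 6, 23), (2, 25, 19, 3, 14), (2, 25, 22,
    3, 11), (2, 26, 7, 3, 25), (2, 26, 11, 3, 21), (2, 26, 19, 5, 11), (2, 26, 19, 9, 7), (2,
    27, 14, 17, 3), (2, 27, 17, 2, 15), (2, 27, 18, 3, 13), (2, 27, 18, 5, 11), (2, 27, 18, 9,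
    7), (2, 27, 23, 8, 3), (2, 27, 24, 3, 7), (4, 15, 13, 3, 28), (4, 19, 7, 5, 28), (4, 21, 7,
    3, 28), (4, 21, 7, 9, 22), (4, 21, 7, 17, 14), (4, 21, 19, 5, 14), (4, 23, 12, 3, 21), (4,
    23, 14, 17, 5), (4, 23, 17, 4, 15), (4, 23, 23, 8, 5), (4, 23, 29, 4, 3), (4, 25, 21, 6, 7),
    (4, 27, 20, 5, 7), (4, 28, 7, 3, 21), (4, 28, 19, 5, 7), (4, 29, 13, 2, 15), (4, 29, 14, 3,
    13), (4, 29, 18, 5, 7), (4, 29, 21, 2, 7), (4, 29, 22, 3, 5), (4, 29, 22, 5, 3), (4, 29, 23,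
    4, 3), (8, 15, 9, 5, 26), (8, 15, 23, 8, 9), (8, 15, 25, 6, 9), (8, 15, 25, 8, 7), (8, 19,
    13, 9, 14), (8, 23, 9, 8, 15), (8, 25, 7, 8, 15), (8, 25, 7, 9, 14), (8, 25, 14, 9, 7), (8,
    26, 11, 5, 13), (8, 26, 13, 3, 13), (8, 27, 12, 3, 13), (8, 29, 13, 2, 11), (8, 29, 14, 3,
    9), (8, 29, 14, 9, 3)]),
  ([13,12,5,3,3], [(1, 7, 25, 25, 5), (1, 25, 7, 29, 1), (1, 25, 29, 7, 1), (1, 27, 25, 5, 5),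
    (1, 29, 3, 13, 17), (1, 29, 3, 29, 1), (1, 29, 17, 11, 5), (1, 29, 17, 15, 1), (1, 29, 25,
    3, 5), (2, 7, 25, 23, 6), (2, 7, 25, 26, 3), (2, 7, 26, 25, 3), (2, 11, 19, 23, 8), (2, 17,
    23, 15, 6), (2, 17, 27, 15, 2), (2, 19, 25, 15, 2), (2, 21, 11, 27, 2), (2, 23, 7, 30, 1),
    (2, 23, 30, 7, 1), (2, 26, 7, 27, 1), (2, 26, 27, 7, 1), (2, 27, 3, 28, 3), (2, 27, 3, 30,
    1), (2, 27, 5, 26, 3), (2, 27, 25, 3, 6), (2, 27, 25, 6, 3), (2, 27, 26, 3, 5), (2, 27, 28,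
    3, 3), (2, 27, 30, 3, 1), (2, 29, 3, 19, 10), (2, 29, 3, 27, 2), (2, 29, 18, 11, 3), (2, 30,
    3, 25, 3), (2, 30, 3, 27, 1), (2, 30, 17, 11, 3), (2, 30, 25, 3, 3), (4, 7, 21, 27, 4), (4,
    7, 21, 28, 3), (4, 7, 28, 21, 3), (4, 13, 19, 23, 4), (4, 13, 29, 15, 2), (4, 15, 13, 28,
    3), (4, 15, 28, 13, 3), (4, 17, 23, 15, 4), (4, 21, 7, 29, 2), (4, 21, 13, 23, 2), (4, 21,
    21, 15, 2), (4, 21, 29, 7, 2), (4, 23, 5, 28, 3), (4, 23, 5, 30, 1), (4, 23, 28, 5, 3), (4,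
    23, 30, 5, 1), (4, 27, 3, 26, 3), (4, 28, 7, 23, 1), (4, 28, 15, 15, 1), (4, 28, 23, 7, 1),
    (4, 29, 3, 15, 12), (4, 29, 3, 22, 5), (4, 29, 3, 23, 4), (4, 29, 5, 19, 6), (4, 29, 5, 23,
    2), (4, 29, 14, 13, 3), (4, 29, 14, 15, 1), (4, 29, 20, 7, 3), (4, 29, 22, 5, 3), (4, 29,
    22, 7, 1), (4, 30, 3, 21, 5), (4, 30, 5, 21, 3), (4, 30, 5, 23, 1), (8, 7, 21, 23, 4), (8,
    9, 25, 15, 6), (8, 11, 13, 28, 3), (8, 11, 25, 15, 4), (8, 11, 28, 13, 3), (8, 13, 11, 27,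
    4), (8, 13, 29, 11, 2), (8, 15, 9, 28, 3), (8, 15, 28, 9, 3), (8, 25, 13, 15, 2), (8, 28,
    11, 15, 1), (8, 28, 15, 11, 1), (8, 29, 3, 13, 10), (8, 29, 3, 14, 9), (8, 29, 3, 15, 8),
    (8, 29, 9, 11, 6), (8, 29, 9, 15, 2), (8, 29, 14, 9, 3), (8, 29, 14, 11, 1), (8, 30, 3, 13,
    9), (8, 30, 9, 13, 3), (8, 30, 9, 15, 1)])]

set_option maxRecDepth 100000 in
lemma validRule_of_mem_rules : ∀ r ∈ rules, ValidRule r.1 r.2 := by decide +kernel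

/-- A word starting with the leading word of a rule. -/
def HeadReducible (w : List ℕ) : Prop := (rules.any fun r => r.1.isPrefixOf w) = true

instance (w : List ℕ) : Decidable (HeadReducible w) := by unfold HeadReducible; infer_instance

/-- A word containing the leading word of a rule. -/
def Reducible : List ℕ → Prop
  | [] => False
  | c :: w => HeadReducible (c :: w) ∨ Reducible w

lemma HeadReducible.append {u : List ℕ} (h : HeadReducible u) (v : List ℕ) :
    HeadReducible (u ++ v) := by
  rw [HeadReducible, List.any_eq_true] at h ⊢
  obtain ⟨r, hr, h⟩ := h
  rw [List.isPrefixOf_iff_prefix] at h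
  exact ⟨r, hr, List.isPrefixOf_iff_prefix.2 (h.trans (List.prefix_append u v))⟩

lemma HeadReducible.mon_mem {w : List ℕ} (h : HeadReducible w) :
    mon (toExpo w) ∈ reducedSpan w.length (toExpo w) := by
  rw [HeadReducible, List.any_eq_true] at h
  obtain ⟨r, hr, h⟩ := h
  obtain ⟨v, rfl⟩ := List.isPrefixOf_iff_prefix.1 h
  exact (validRule_of_mem_rules r hr).mon_mem v

lemma Reducible.mon_mem {w : List ℕ} (h : Reducible w) :
    mon (toExpo w) ∈ reducedSpan w.length (toExpo w) := by
  induction w with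
  | nil => exact h.elim
  | cons c w ih => exact h.elim HeadReducible.mon_mem fun h => mon_mem_reducedSpan_succ (bits_le c) (ih h)

/-- The word of the first `L` binary digits of an exponent. -/
def digits : ℕ → Expo → List ℕ
  | 0, _ => []
  | L + 1, a => parityCode a :: digits L (half a)

lemma length_digits (L : ℕ) (a : Expo) : (digits L a).length = L := by
  induction L generalizing a with
  | zero => rfl
  | succ L ih => rw [digits, List.length_cons, ih]

lemma lt_of_mem_digits {L : ℕ} {a : Expo} : ∀ c ∈ digits L a, c < 16 := by
  induction L generalizing a with
  | zero => simp [digits]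
  | succ L ih =>
    intro c hc
    rcases List.mem_cons.1 hc with rfl | hc
    · unfold parityCode; omega
    · exact ih c hc

lemma bits_parityCode_add (a : Expo) : bits (parityCode a) + 2 • half a = a := by
  simp only [bits, parityCode, half, Prod.smul_mk, Prod.mk_add_mk, smul_eq_mul]
  ext <;> simp only <;> omega

lemma toExpo_digits {L : ℕ} {a : Expo} (ha : AllLT (2 ^ L) a) : toExpo (digits L a) = a := by
  induction L generalizing a with
  | zero => exact ha.eq_zero.symm
  | succ L ih => rw [digits, toExpo, ih ha.half, bits_parityCode_add]

lemma mon_mem_hit_sup_span {L : ℕ} {B : Set (List ℕ)}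
    (hB : ∀ w : List ℕ, w.length = L → (∀ c ∈ w, c < 16) → deg (toExpo w) = 2 ^ L - 1 →
      ¬ Reducible w → w ∈ B) (a : Expo) (ha : deg a = 2 ^ L - 1) :
    mon a ∈ hitSubmodule 4 ⊔ Submodule.span (ZMod 2) ((fun w => mon (toExpo w)) '' B) := by
  have hwf : WellFounded (fun b a : Expo => Lower L b a) := by
    refine Subrelation.wf (fun {b a} h => ?_)
      (InvImage.wf (fun a => toLex (weightKey L a, codeKey L a)) wellFounded_lt)
    exact Prod.Lex.toLex_lt_toLex.2 h
  induction a using hwf.induction with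
  | _ a ih =>
  have hlt : AllLT (2 ^ L) a := by
    have := Nat.one_le_two_pow (n := L)
    simp only [deg] at ha
    refine ⟨?_, ?_, ?_, ?_⟩ <;> omega
  have hw := toExpo_digits hlt
  by_cases h : Reducible (digits L a)
  · have := h.mon_mem
    rw [hw, length_digits] at this
    refine (Submodule.span_le.2 ?_ : reducedSpan L a ≤ _) this
    rintro _ (⟨l, h, hl, -, rfl⟩ | ⟨b, hd, hb, rfl⟩)
    · exact Submodule.mem_sup_left (sqAct_mon_mem_hitSubmodule hl h)
    · exact ih b hb (hd.trans ha)
  · refine Submodule.mem_sup_right (Submodule.subset_span ⟨digits L a, ?_, by simp only [hw]⟩)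
    exact hB _ (length_digits L a) lt_of_mem_digits (by rw [hw, ha]) h

lemma sqAct_add (l : ℕ) (φ ψ : Expo → ZMod 2) (a : Expo) :
    sqAct l (φ + ψ) a = sqAct l φ a + sqAct l ψ a := by
  have h := multiBinSum_sum Finset.univ a
    fun (i : Bool) b => if deg b = l then (bif i then φ else ψ) (a + b) else 0
  simp only [Fintype.sum_bool, cond_true, cond_false] at h
  rw [sqAct, sqAct, sqAct, ← h]
  congr 1
  funext b
  split_ifs <;> simp

lemma annihilated_zero : Annihilated 0 := fun l _ a => by
  simp [sqAct, multiBinSum_zero]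

lemma Annihilated.add {φ ψ : Expo → ZMod 2} (hφ : Annihilated φ) (hψ : Annihilated ψ) :
    Annihilated (φ + ψ) := fun l hl a => by
  rw [sqAct_add, hφ l hl, hψ l hl, add_zero]

/-- The indicator function of the exponent `(2 ^ p - 1, 2 ^ q - 1, 0, 0)`. -/
def spike (p q : ℕ) (a : Expo) : ZMod 2 :=
  if a.1 = 2 ^ p - 1 then if a.2.1 = 2 ^ q - 1 then if a.2.2.1 = 2 ^ 0 - 1 then
    if a.2.2.2 = 2 ^ 0 - 1 then 1 else 0 else 0 else 0 else 0

lemma ite_binSum (P : Prop) [Decidable P] (n : ℕ) (Φ : ℕ → ZMod 2) :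
    binSum n (fun b => if P then Φ b else 0) = if P then binSum n Φ else 0 := by
  split_ifs <;> simp [binSum_zero]

lemma multiBinSum_spike (p q : ℕ) (a : Expo) :
    multiBinSum a (fun b => spike p q (a + b)) = spike p q a := by
  simp only [multiBinSum, spike, Prod.fst_add, Prod.snd_add, ite_binSum, binSum_two_pow_sub_one]

lemma spike_eq (p q : ℕ) (a : Expo) :
    spike p q a = if a = (2 ^ p - 1, 2 ^ q - 1, 0, 0) then 1 else 0 := by
  obtain ⟨a₀, a₁, a₂, a₃⟩ := a
  simp only [spike, Prod.mk.injEq, pow_zero, Nat.sub_self, ite_and]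

lemma functional_spike_SqTotal (p q : ℕ) (f : P4) :
    functional (spike p q) (SqTotal 4 f) = functional (spike p q) f := by
  have : functional (spike p q) ∘ₗ (SqTotal 4).toLinearMap = functional (spike p q) := by
    refine linearMap_ext_mon fun a => ?_
    rw [LinearMap.comp_apply, AlgHom.toLinearMap_apply, SqTotal_mon, map_multiBinSum]
    simp only [functional_mon, multiBinSum_spike]
  exact LinearMap.congr_fun this f

/-- The binary digit of `v` at place `j` as an element of `F_2`. -/
def digit (v : ℕ) (j : ℕ) : ZMod 2 := if v.testBit j then 1 else 0

/-- The linear substitution `x_j ↦ v_j x_0 + w_j x_1`, where `v_j` and `w_j` are binary digits. -/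
noncomputable def subst (v w : ℕ) : P4 →ₐ[ZMod 2] P4 :=
  aeval fun j => digit v j • X 0 + digit w j • X 1

lemma zmod_two_sq (c : ZMod 2) : c ^ 2 = c := by revert c; decide

lemma SqTotal_subst (v w : ℕ) (f : P4) : SqTotal 4 (subst v w f) = subst v w (SqTotal 4 f) := by
  have : (SqTotal 4).comp (subst v w) = (subst v w).comp (SqTotal 4) := by
    refine algHom_ext fun j => ?_
    simp only [SqTotal, subst, AlgHom.comp_apply, aeval_X, map_add, map_pow, map_smul, CharTwo.add_sq,
      smul_pow, zmod_two_sq, smul_add]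
    abel
  exact DFunLike.congr_fun this f

lemma isHomogeneous_subst_mon (v w : ℕ) (a : Expo) : (subst v w (mon a)).IsHomogeneous (deg a) := by
  have h : ∀ (j : Fin 4) n, ((digit v j • X 0 + digit w j • X 1 : P4) ^ n).IsHomogeneous n := by
    intro j n
    have h1 : (digit v j • X 0 + digit w j • X 1 : P4) ∈ homogeneousSubmodule (Fin 4) (ZMod 2) 1 :=
      add_mem (Submodule.smul_mem _ _ ((mem_homogeneousSubmodule _ _).2 (isHomogeneous_X _ _)))
        (Submodule.smul_mem _ _ ((mem_homogeneousSubmodule _ _).2 (isHomogeneous_X _ _)))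
    have := ((mem_homogeneousSubmodule _ _).1 h1).pow n
    rwa [one_mul] at this
  have := (h 0 a.1).mul ((h 1 a.2.1).mul ((h 2 a.2.2.1).mul (h 3 a.2.2.2)))
  rw [← add_assoc, ← add_assoc] at this
  simp only [mon, subst, map_mul, map_pow, aeval_X]
  exact this

lemma functional_eq_zero_of_isHomogeneous {φ : Expo → ZMod 2} {d : ℕ} (hφ : ∀ a, deg a = d → φ a = 0)
    {f : P4} (hf : f.IsHomogeneous d) : functional φ f = 0 := by
  have : functional φ ∘ₗ homogeneousComponent d = 0 := by
    refine linearMap_ext_mon fun a => ?_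
    rw [LinearMap.comp_apply, homogeneousComponent_mon]
    split_ifs with h
    · rw [functional_mon, hφ a h, LinearMap.zero_apply]
    · simp
  have h := LinearMap.congr_fun this f
  rwa [LinearMap.comp_apply, homogeneousComponent_of_mem ((mem_homogeneousSubmodule _ _).2 hf),
    if_pos rfl] at h

/-- The pullback of the indicator function of a spike along a linear substitution. -/
noncomputable def pullSpike (p q v w : ℕ) (a : Expo) : ZMod 2 :=
  functional (spike p q) (subst v w (mon a))

lemma pullSpike_eq_zero {p q : ℕ} (v w : ℕ) {a : Expo} (ha : deg a ≠ 2 ^ p - 1 + (2 ^ q - 1)) :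
    pullSpike p q v w a = 0 := by
  refine functional_eq_zero_of_isHomogeneous (fun b hb => ?_) (isHomogeneous_subst_mon v w a)
  rw [spike_eq, if_neg]
  rintro rfl
  exact ha (by rw [← hb]; simp [deg])

lemma annihilated_of_multiBinSum {φ : Expo → ZMod 2} {N : ℕ} (h0 : ∀ a, deg a ≠ N → φ a = 0)
    (h : ∀ a, deg a ≠ N → multiBinSum a (fun b => φ (a + b)) = 0) : Annihilated φ := by
  intro l hl a
  by_cases hN : deg a + l = N
  · rw [← h a (by omega), sqAct]
    congr 1
    funext b
    split_ifs with hb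
    · rfl
    · rw [h0 _ (by rw [deg_add]; omega)]
  · have : (fun b => if deg b = l then φ (a + b) else 0) = fun _ => 0 := by
      funext b
      split_ifs with hb
      · rw [h0 _ (by rw [deg_add]; omega)]
      · rfl
    rw [sqAct, this, multiBinSum_zero]

lemma annihilated_pullSpike (p q v w : ℕ) : Annihilated (pullSpike p q v w) := by
  refine annihilated_of_multiBinSum (fun a => pullSpike_eq_zero v w) fun a ha => ?_
  have h := map_multiBinSum (functional (spike p q) ∘ₗ (subst v w).toLinearMap) a fun b => mon (a + b)
  refine h.symm.trans ?_
  rw [← pullSpike_eq_zero v w ha, pullSpike, ← functional_spike_SqTotal, SqTotal_subst, SqTotal_mon]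
  rfl

lemma spike_add_two_nsmul (p q : ℕ) {c : Expo} (hc : deg c = 2) (b : Expo) :
    spike (p + 1) (q + 1) (c + 2 • b) = spike 1 1 c * spike p q b := by
  have hp := Nat.one_le_two_pow (n := p)
  have hq := Nat.one_le_two_pow (n := q)
  obtain ⟨c₀, c₁, c₂, c₃⟩ := c
  obtain ⟨b₀, b₁, b₂, b₃⟩ := b
  simp only [deg] at hc
  simp only [spike_eq, pow_succ, pow_zero, Prod.smul_mk, Prod.mk_add_mk, smul_eq_mul, Prod.mk.injEq,
    ← ite_and, mul_ite, mul_one, mul_zero]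
  congr 1
  simp only [eq_iff_iff]
  omega

lemma functional_spike_mul_sq (p q : ℕ) {g : P4} (hg : g.IsHomogeneous 2) (f : P4) :
    functional (spike (p + 1) (q + 1)) (g * f ^ 2) =
      functional (spike 1 1) g * functional (spike p q) f := by
  have h1 : ∀ c, deg c = 2 → functional (spike (p + 1) (q + 1)) ∘ₗ mulSq (mon c) =
      functional (spike 1 1) (mon c) • functional (spike p q) := by
    intro c hc
    refine linearMap_ext_mon fun b => ?_
    rw [LinearMap.comp_apply, mulSq_mon, LinearMap.smul_apply, functional_mon, functional_mon,
      functional_mon, spike_add_two_nsmul p q hc, smul_eq_mul]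
  have h2 : functional (spike (p + 1) (q + 1)) ∘ₗ LinearMap.mulRight (ZMod 2) (f ^ 2) ∘ₗ
      homogeneousComponent 2 =
      (functional (spike p q) f) • (functional (spike 1 1) ∘ₗ homogeneousComponent 2) := by
    refine linearMap_ext_mon fun c => ?_
    rw [LinearMap.smul_apply, LinearMap.comp_apply, LinearMap.comp_apply, LinearMap.comp_apply,
      homogeneousComponent_mon]
    split_ifs with hc
    · have := LinearMap.congr_fun (h1 c hc) f
      rw [LinearMap.smul_apply, smul_eq_mul, mul_comm] at this
      exact this
    · simp
  have h := LinearMap.congr_fun h2 g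
  rw [LinearMap.smul_apply, LinearMap.comp_apply, LinearMap.comp_apply, LinearMap.comp_apply,
    homogeneousComponent_of_mem ((mem_homogeneousSubmodule _ _).2 hg), if_pos rfl, smul_eq_mul,
    mul_comm] at h
  exact h

lemma pullSpike_add_two_nsmul (p q v w : ℕ) {c : Expo} (hc : deg c = 2) (b : Expo) :
    pullSpike (p + 1) (q + 1) v w (c + 2 • b) = pullSpike 1 1 v w c * pullSpike p q v w b := by
  have h := isHomogeneous_subst_mon v w c
  rw [hc] at h
  rw [pullSpike, mon_add, mon_two_nsmul, map_mul, map_pow, functional_spike_mul_sq _ _ h]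
  rfl

lemma pullSpike_zero (v w : ℕ) : pullSpike 0 0 v w 0 = 1 := by
  rw [pullSpike, show mon 0 = 1 by simp [mon], map_one, show (1 : P4) = mon 0 by simp [mon],
    functional_mon, spike_eq]
  rfl

lemma pullSpike_zero_right (p v : ℕ) {a : Expo} (ha : deg a = 2 ^ p - 1) :
    pullSpike p 0 v 0 a =
      digit v 0 ^ a.1 * (digit v 1 ^ a.2.1 * (digit v 2 ^ a.2.2.1 * digit v 3 ^ a.2.2.2)) := by
  have h : subst v 0 (mon a) = (digit v 0 ^ a.1 * (digit v 1 ^ a.2.1 *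
      (digit v 2 ^ a.2.2.1 * digit v 3 ^ a.2.2.2))) • mon (deg a, 0, 0, 0) := by
    have h0 : ∀ j, digit 0 j = 0 := fun j => by simp [digit]
    simp only [subst, mon, map_mul, map_pow, aeval_X, h0, zero_smul, add_zero, smul_pow,
      smul_mul_smul_comm, pow_zero, mul_one, deg, pow_add]
    congr 1
    ring
  rw [pullSpike, h, map_smul, functional_mon, spike_eq, ha, if_pos (by simp), smul_eq_mul, mul_one]

/-- The exponent with a single `1` at place `i`. -/
def unit (i : Fin 4) : Expo := bits (2 ^ (i : ℕ))

/-- Given functions `e i` of exponents, the function supported on the exponents with exactly one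
even entry whose value on `x^(2 b) ∏ x_j`, the product running over `j ≠ i`, is `e i b`. -/
def lift (e : Fin 4 → Expo → ZMod 2) (a : Expo) : ZMod 2 :=
  ∑ i : Fin 4, if parity a = bits (15 - 2 ^ (i : ℕ)) then e i (half a) else 0

lemma parity_add_two_nsmul (ε a : Expo) : parity (ε + 2 • a) = parity ε := by
  simp only [parity, Prod.fst_add, Prod.snd_add, Prod.smul_fst, Prod.smul_snd, smul_eq_mul,
    Nat.add_mul_mod_self_left]

lemma half_add_two_nsmul' (ε a : Expo) : half (ε + 2 • a) = half ε + a := by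
  simp only [half, Prod.fst_add, Prod.snd_add, Prod.smul_fst, Prod.smul_snd, smul_eq_mul]
  ext <;> simp only [Prod.fst_add, Prod.snd_add] <;> omega

lemma lift_add_two_nsmul (e : Fin 4 → Expo → ZMod 2) (ε a : Expo) :
    lift e (ε + 2 • a) =
      ∑ i : Fin 4, if parity ε = bits (15 - 2 ^ (i : ℕ)) then e i (half ε + a) else 0 := by
  simp only [lift, parity_add_two_nsmul, half_add_two_nsmul']

lemma eq_bits_of_le {ε : Expo} (h : ε ≤ (1, 1, 1, 1)) : ∃ c < 16, ε = bits c := by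
  obtain ⟨e₀, e₁, e₂, e₃⟩ := ε
  simp only [Prod.mk_le_mk] at h
  refine ⟨e₀ + 2 * e₁ + 4 * e₂ + 8 * e₃, by omega, ?_⟩
  simp only [bits, Prod.mk.injEq]
  omega

lemma filter_parity_add_bits : ∀ c < 16, ∀ i : Fin 4,
    (Finset.Iic (bits c)).filter (fun β => parity (bits c + β) = bits (15 - 2 ^ (i : ℕ))) =
      if c = 15 - 2 ^ (i : ℕ) then {0} else if c = 15 then {unit i} else ∅ := by
  decide +kernel

lemma half_bits_add : ∀ i : Fin 4, half (bits (15 - 2 ^ (i : ℕ)) + 0) = 0 ∧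
    half (bits 15 + unit i) = unit i ∧ deg (unit i) = 1 := by
  decide +kernel

lemma sqAct_lift (e : Fin 4 → Expo → ZMod 2) (l : ℕ) {c : ℕ} (hc : c < 16) (h : Expo) :
    sqAct l (lift e) (bits c + 2 • h) = ∑ i : Fin 4,
      if c = 15 - 2 ^ (i : ℕ) then multiBinSum h fun b => if 2 * deg b = l then e i (h + b) else 0
      else if c = 15 then
        multiBinSum h fun b => if 1 + 2 * deg b = l then e i (unit i + (h + b)) else 0
      else 0 := by
  rw [sqAct, multiBinSum_add_two_nsmul (bits_le c)]
  have key : ∀ β : Expo, (multiBinSum h fun b => if deg (β + 2 • b) = l then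
        lift e (bits c + 2 • h + (β + 2 • b)) else 0) =
      ∑ i : Fin 4, if parity (bits c + β) = bits (15 - 2 ^ (i : ℕ)) then multiBinSum h fun b =>
        if deg β + 2 * deg b = l then e i (half (bits c + β) + (h + b)) else 0 else 0 := by
    intro β
    have h1 : ∀ i : Fin 4, (if parity (bits c + β) = bits (15 - 2 ^ (i : ℕ)) then multiBinSum h
        fun b => if deg β + 2 * deg b = l then e i (half (bits c + β) + (h + b)) else 0 else 0) =
        multiBinSum h fun b => if parity (bits c + β) = bits (15 - 2 ^ (i : ℕ)) then
          if deg β + 2 * deg b = l then e i (half (bits c + β) + (h + b)) else 0 else 0 := by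
      intro i
      split_ifs
      · rfl
      · rw [multiBinSum_zero]
    rw [Finset.sum_congr rfl fun i _ => h1 i, ← multiBinSum_sum]
    congr 1
    funext b
    rw [add_two_nsmul_add, lift_add_two_nsmul, deg_add, deg_nsmul]
    split_ifs with hb
    · rfl
    · simp
  rw [Finset.sum_congr rfl fun β _ => key β, Finset.sum_comm]
  refine Finset.sum_congr rfl fun i _ => ?_
  obtain ⟨hi, hi', hi''⟩ := half_bits_add i
  rw [← Finset.sum_filter, filter_parity_add_bits c hc i]
  split_ifs with h1 h2
  · rw [Finset.sum_singleton, h1, hi]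
    simp only [show deg 0 = 0 from rfl, zero_add]
  · rw [Finset.sum_singleton, h2, hi', hi'']
  · rw [Finset.sum_empty]

lemma annihilated_lift {e : Fin 4 → Expo → ZMod 2} (he : ∀ i, Annihilated (e i))
    (hsum : ∀ h, ∑ i, e i (unit i + h) = 0) : Annihilated (lift e) := by
  intro l hl a
  obtain ⟨c, hc, hca⟩ := eq_bits_of_le (parity_le a)
  rw [← parity_add_half a, hca, sqAct_lift e l hc]
  by_cases hc' : c = 15
  · have h15 : ∀ i : Fin 4, c ≠ 15 - 2 ^ (i : ℕ) := by subst hc'; decide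
    simp only [if_neg (h15 _), if_pos hc']
    rw [← multiBinSum_sum]
    refine Eq.trans ?_ (multiBinSum_zero (half a))
    congr 1
    funext b
    rw [← hsum (half a + b)]
    split_ifs
    · rfl
    · rw [hsum, Finset.sum_const_zero]
  · refine Finset.sum_eq_zero fun i _ => ?_
    rw [if_neg hc']
    split_ifs
    · rcases Nat.even_or_odd' l with ⟨k, rfl | rfl⟩
      · refine Eq.trans ?_ (he i k (by omega) (half a))
        simp only [sqAct, mul_eq_mul_left_iff, OfNat.ofNat_ne_zero, or_false]
      · simp only [show ∀ x, ¬ (2 * x = 2 * k + 1) by omega, if_false, multiBinSum_zero]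
    · rfl

lemma digit_smul {M : Type*} [AddCommGroup M] [Module (ZMod 2) M] (u j : ℕ) (x : M) :
    digit u j • x = if u.testBit j then x else 0 := by
  unfold digit
  split_ifs <;> simp

lemma Annihilated.smul {φ : Expo → ZMod 2} (hφ : Annihilated φ) (u j : ℕ) :
    Annihilated (digit u j • φ) := by
  rw [digit_smul]
  split_ifs
  exacts [hφ, annihilated_zero]

lemma mon_unit (i : Fin 4) : mon (unit i) = X i := by
  fin_cases i <;> simp [mon, unit, bits]

/-- The functional attached to a flag: `v` and `w` span a plane orthogonal to `u`. -/
noncomputable def flag (t u v w : ℕ) : Expo → ZMod 2 :=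
  lift fun i => digit u i • pullSpike t t v w

lemma annihilated_flag (t u v w : ℕ) (hv : ∑ i : Fin 4, digit u i * digit v i = 0)
    (hw : ∑ i : Fin 4, digit u i * digit w i = 0) : Annihilated (flag t u v w) := by
  refine annihilated_lift (fun i => (annihilated_pullSpike t t v w).smul u i) fun h => ?_
  have h1 : ∑ i : Fin 4, digit u i • (X i : P4) ∈ LinearMap.ker (subst v w).toLinearMap := by
    simp only [LinearMap.mem_ker, AlgHom.toLinearMap_apply, map_sum, map_smul, subst, aeval_X,
      smul_add, smul_smul, Finset.sum_add_distrib, ← Finset.sum_smul, hv, hw, zero_smul, add_zero]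
  have h2 : subst v w ((∑ i : Fin 4, digit u i • (X i : P4)) * mon h) = 0 := by
    rw [map_mul, show subst v w _ = 0 from h1, zero_mul]
  have h3 := congrArg (functional (spike t t)) h2
  rw [map_zero, Finset.sum_mul, map_sum, map_sum] at h3
  rw [← h3]
  refine Finset.sum_congr rfl fun i _ => ?_
  rw [smul_mul_assoc, ← mon_unit, ← mon_add, map_smul, map_smul]
  rfl

/-- The number of odd entries of an exponent with parity code `c`. -/
def pop (c : ℕ) : ℕ := deg (bits c)

lemma cast_toNat_and : ∀ a b : Bool,
    (((a && b).toNat : ℕ) : ZMod 2) = (a.toNat : ZMod 2) * (b.toNat : ZMod 2) := by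
  decide

/-- The parity of the minor of the matrix with rows `v` and `w` given by the two columns in `c`. -/
def minor (v w c : ℕ) : Bool :=
  (pop (v &&& c) * pop (w &&& c) + pop (v &&& w &&& c)) % 2 == 1

lemma functional_spike_one_one (a b c d : ZMod 2) :
    functional (spike 1 1) ((a • X 0 + b • X 1) * (c • X 0 + d • X 1)) = a * d + b * c := by
  have h : ((a • X 0 + b • X 1) * (c • X 0 + d • X 1) : P4) = (a * c) • mon (2, 0, 0, 0) +
      (a * d) • mon (1, 1, 0, 0) + (b * c) • mon (1, 1, 0, 0) + (b * d) • mon (0, 2, 0, 0) := by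
    simp only [mon, smul_eq_C_mul, C_mul]
    ring
  rw [h]
  simp [functional_mon, spike_eq]

lemma minor_eq : ∀ v < 16, ∀ w < 16, ∀ p < 4, ∀ q < p,
    digit v q * digit w p + digit w q * digit v p = (minor v w (2 ^ q + 2 ^ p)).toNat := by
  decide +kernel

lemma exists_of_pop_eq_two : ∀ c < 16, pop c = 2 → ∃ p < 4, ∃ q < p, c = 2 ^ q + 2 ^ p := by
  decide +kernel

lemma pullSpike_one_one {v w c : ℕ} (hv : v < 16) (hw : w < 16) (hc : c < 16) (h : pop c = 2) :
    pullSpike 1 1 v w (bits c) = (minor v w c).toNat := by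
  obtain ⟨p, hp, q, hq, rfl⟩ := exists_of_pop_eq_two c hc h
  rw [← minor_eq v hv w hw p hp q hq, ← functional_spike_one_one, pullSpike]
  congr 1
  interval_cases p <;> interval_cases q <;> simp [mon, subst, bits]

lemma pullSpike_toExpo {v w : ℕ} (hv : v < 16) (hw : w < 16) {x : List ℕ}
    (hx : ∀ c ∈ x, c < 16 ∧ pop c = 2) :
    pullSpike x.length x.length v w (toExpo x) = (x.all (minor v w)).toNat := by
  induction x with
  | nil => simpa [toExpo] using pullSpike_zero v w
  | cons c x ih =>
    have hc := hx c (by simp)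
    rw [List.length_cons, toExpo, pullSpike_add_two_nsmul _ _ _ _ hc.2,
      ih fun d hd => hx d (by simp [hd]), pullSpike_one_one hv hw hc.1 hc.2, List.all_cons,
      cast_toNat_and]

lemma digit_or_eq : ∀ v < 16, ∀ c < 16, (digit v 0 ^ (bits c).1 * (digit v 1 ^ (bits c).2.1 *
    (digit v 2 ^ (bits c).2.2.1 * digit v 3 ^ (bits c).2.2.2))) = (c ||| v == v).toNat := by
  decide +kernel

lemma digit_pow_toExpo {v : ℕ} (hv : v < 16) {x : List ℕ} (hx : ∀ c ∈ x, c < 16) :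
    digit v 0 ^ (toExpo x).1 * (digit v 1 ^ (toExpo x).2.1 *
      (digit v 2 ^ (toExpo x).2.2.1 * digit v 3 ^ (toExpo x).2.2.2)) =
      (x.all (fun c => c ||| v == v)).toNat := by
  induction x with
  | nil => simp [toExpo]
  | cons c x ih =>
    rw [List.all_cons, cast_toNat_and, ← ih fun d hd => hx d (by simp [hd]),
      ← digit_or_eq v hv c (hx c (by simp))]
    simp only [toExpo, Prod.fst_add, Prod.snd_add, Prod.smul_fst, Prod.smul_snd, smul_eq_mul,
      pow_add, pow_mul, zmod_two_sq]
    ring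

/-- The value at a word of a functional obtained by `lift`. -/
def liftVal (p : ℕ → List ℕ → Bool) : List ℕ → Bool
  | [] => false
  | c :: x => (List.range 4).any fun i => c == 15 - 2 ^ i && p i x

lemma bits_eq_iff : ∀ c < 16, ∀ i : Fin 4,
    bits c = bits (15 - 2 ^ (i : ℕ)) ↔ c = 15 - 2 ^ (i : ℕ) := by
  decide +kernel

lemma lift_bits_add {e : Fin 4 → Expo → ZMod 2} {c : ℕ} (hc : c < 16) (a : Expo) :
    lift e (bits c + 2 • a) = ∑ i : Fin 4, if c = 15 - 2 ^ (i : ℕ) then e i a else 0 := by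
  have h : parity (bits c) = bits c ∧ half (bits c) = 0 := by
    revert c
    decide +kernel
  rw [lift_add_two_nsmul, h.1, h.2]
  simp only [bits_eq_iff c hc, zero_add]

lemma sum_ite_eq_any : ∀ c < 16, ∀ a b d f : Bool, ((if (c == 15 - 2 ^ 0 && a) then 1 else 0) +
    (if (c == 15 - 2 ^ 1 && b) then 1 else 0) + (if (c == 15 - 2 ^ 2 && d) then 1 else 0) +
    (if (c == 15 - 2 ^ 3 && f) then 1 else 0) : ZMod 2) = ((c == 15 - 2 ^ 0 && a) ||
    ((c == 15 - 2 ^ 1 && b) || ((c == 15 - 2 ^ 2 && d) || ((c == 15 - 2 ^ 3 && f) || false)))).toNat := by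
  decide +kernel

lemma lift_toExpo {e : Fin 4 → Expo → ZMod 2} {p : ℕ → List ℕ → Bool} {c : ℕ} (hc : c < 16)
    {x : List ℕ} (h : ∀ i : Fin 4, e i (toExpo x) = (p i x).toNat) :
    lift e (toExpo (c :: x)) = (liftVal p (c :: x)).toNat := by
  rw [toExpo, lift_bits_add hc]
  simp only [h]
  simp only [liftVal, Fin.sum_univ_four]
  have h1 : ∀ i : ℕ, (if c = 15 - 2 ^ i then ((p i x).toNat : ZMod 2) else 0) =
      (if (c == 15 - 2 ^ i && p i x) then 1 else 0) := by
    intro i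
    by_cases h : c = 15 - 2 ^ i <;> cases p i x <;> simp [h]
  simp only [h1]
  exact sum_ite_eq_any c hc _ _ _ _

lemma lift_toExpo_eq_zero {e : Fin 4 → Expo → ZMod 2} {c : ℕ} (hc : c < 16) (h : pop c ≠ 3)
    (x : List ℕ) : lift e (toExpo (c :: x)) = 0 := by
  rw [toExpo, lift_bits_add hc]
  refine Finset.sum_eq_zero fun i _ => if_neg ?_
  rintro rfl
  revert h
  revert i
  decide

lemma digit_xor (a b j : ℕ) : digit (a ^^^ b) j = digit a j + digit b j := by
  simp only [digit, Nat.testBit_xor]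
  cases a.testBit j <;> cases b.testBit j <;> decide

lemma digit_zero (j : ℕ) : digit 0 j = 0 := by simp [digit]

/-- Bitwise sum modulo 2. -/
def xorSum (l : List ℕ) : ℕ := l.foldr (· ^^^ ·) 0

lemma digit_xorSum (l : List ℕ) (j : ℕ) : digit (xorSum l) j = (l.map fun c => digit c j).sum := by
  induction l with
  | nil => simp [xorSum, digit_zero]
  | cons c l ih =>
    rw [List.map_cons, List.sum_cons, ← ih, ← digit_xor]
    rfl

/-- Access to the entries of a list, by structural recursion. -/
def entry {α : Type} (z : α) : List α → ℕ → α
  | [], _ => z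
  | c :: _, 0 => c
  | _ :: l, n + 1 => entry z l n

/-- Access to a table by the first three entries of an exponent. -/
def lookup (T : List (List (List ℕ))) (a : Expo) : ℕ :=
  entry 0 (entry [] (entry [] T a.1) a.2.1) a.2.2.1

/-- A Boolean check on all exponents of degree less than `m`. -/
def allBelow (m : ℕ) (p : Expo → Bool) : Bool :=
  (List.range m).all fun a₀ => (List.range (m - a₀)).all fun a₁ =>
    (List.range (m - a₀ - a₁)).all fun a₂ => (List.range (m - a₀ - a₁ - a₂)).all fun a₃ =>
      p (a₀, a₁, a₂, a₃)

lemma of_allBelow {m : ℕ} {p : Expo → Bool} (h : allBelow m p = true) {a : Expo} (ha : deg a < m) :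
    p a = true := by
  simp only [allBelow, List.all_eq_true, List.mem_range] at h
  simp only [deg] at ha
  exact h a.1 (by omega) a.2.1 (by omega) a.2.2.1 (by omega) a.2.2.2 (by omega)

/-- Tables whose entries are packed values of four quadruples of functions on the exponents of
degree `m`, each quadruple satisfying the hypotheses of `annihilated_lift`. -/
def ValidTable (m : ℕ) (T : List (List (List ℕ))) : Prop :=
  m < 17 ∧ allBelow m (fun a =>
    xorSum ((oddChoose 4 (m - deg a) a).map fun b => lookup T (a + b)) == 0) = true ∧
  allBelow m (fun h => deg h != m - 1 || (((lookup T (unit 0 + h)) ^^^ (lookup T (unit 1 + h) >>> 1) ^^^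
    (lookup T (unit 2 + h) >>> 2) ^^^ (lookup T (unit 3 + h) >>> 3)) &&& 0x1111 == 0)) = true

/-- The functions encoded by a table. -/
def tableFn (m : ℕ) (T : List (List (List ℕ))) (j : ℕ) (a : Expo) : ZMod 2 :=
  if deg a = m then digit (lookup T a) j else 0

lemma annihilated_tableFn {m : ℕ} {T : List (List (List ℕ))} (h : ValidTable m T) (j : ℕ) :
    Annihilated (tableFn m T j) := by
  intro l hl a
  by_cases hm : deg a + l = m
  · have h1 := of_allBelow h.2.1 (a := a) (by omega)
    have h2 : AllLT (2 ^ 4) a := by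
      have := h.1
      simp only [deg] at hm
      refine ⟨?_, ?_, ?_, ?_⟩ <;> omega
    rw [beq_iff_eq, show m - deg a = l by omega] at h1
    have h3 := digit_xorSum ((oddChoose 4 l a).map fun b => lookup T (a + b)) j
    rw [h1, digit_zero, List.map_map] at h3
    rw [h3]
    refine Eq.trans ?_ (multiBinSum_eq_sum_oddChoose 4 l h2 fun b => digit (lookup T (a + b)) j)
    rw [sqAct]
    congr 1
    funext b
    split_ifs with hb
    · rw [tableFn, if_pos (by rw [deg_add, hb, hm])]
    · rfl
  · refine Eq.trans ?_ (multiBinSum_zero a)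
    rw [sqAct]
    congr 1
    funext b
    split_ifs with hb
    · rw [tableFn, if_neg (by rw [deg_add, hb]; exact hm)]
    · rfl

lemma digit_shiftRight (a i j : ℕ) : digit (a >>> i) j = digit a (j + i) := by
  rw [digit, digit, Nat.testBit_shiftRight, add_comm]

lemma digit_and_eq_zero {a b j : ℕ} (h : a &&& b = 0) (hb : b.testBit j) : digit a j = 0 := by
  have := congrArg (fun c => c.testBit j) h
  simp only [Nat.testBit_and, hb, Bool.and_true, Nat.zero_testBit] at this
  simp [digit, this]

lemma sum_tableFn {m : ℕ} {T : List (List (List ℕ))} (h : ValidTable m T) {k : ℕ} (hk : k < 4)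
    (a : Expo) : ∑ i : Fin 4, tableFn m T (4 * k + i) (unit i + a) = 0 := by
  have hu i : deg (unit i) = 1 := (half_bits_add i).2.2
  by_cases hm : 1 + deg a = m
  · have h1 := of_allBelow h.2.2 (a := a) (by omega)
    have h2 : (deg a != m - 1) = false := by simp; omega
    rw [h2, Bool.false_or, beq_iff_eq] at h1
    have h3 := digit_and_eq_zero (j := 4 * k) h1 (by interval_cases k <;> decide)
    simp only [tableFn, deg_add, hu, hm, if_true, Fin.sum_univ_four]
    simp only [digit_xor, digit_shiftRight] at h3
    exact h3
  · refine Finset.sum_eq_zero fun i _ => if_neg ?_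
    rwa [deg_add, hu]

/-- The `k`-th functional attached to a table. -/
def extra (m : ℕ) (T : List (List (List ℕ))) (k : ℕ) : Expo → ZMod 2 :=
  lift fun i => tableFn m T (4 * k + i)

lemma annihilated_extra {m : ℕ} {T : List (List (List ℕ))} (h : ValidTable m T) {k : ℕ}
    (hk : k < 4) : Annihilated (extra m T k) :=
  annihilated_lift (fun _ => annihilated_tableFn h _) (sum_tableFn h hk)

/-- A table for degree 6. -/
def tableSix : List (List (List ℕ)) :=
  [[[0, 0, 0, 4]], [[0, 0, 1], [0, 2, 0, 128], [0, 0, 0, 32], [0, 2048, 1024]], [[0, 1], [0, 0, 0,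
  32], [], [0, 1024]], [[0, 0, 0, 16], [0, 32768, 16384], [0, 16384], [8448]]]

/-- A table for degree 14. -/
def tableFourteen : List (List (List ℕ)) :=
  [[[], [], [], [0, 0, 0, 0, 0, 28, 28], [], [0, 0, 0, 28, 0, 0, 28], [0, 0, 0, 28, 0, 28], [0, 2,
  2, 2, 2, 2, 2]], [[], [], [], [0, 0, 0, 8, 129, 196, 69, 4], [], [0, 0, 129, 69, 0, 129, 69],
  [0, 129, 0, 196, 0, 196, 129, 64], [0, 34, 34, 32, 34, 34]], [[], [], [], [0, 0, 0, 129, 129,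
  69, 69], [], [0, 0, 129, 196, 0, 129, 196, 64], [0, 129, 0, 196, 0, 69], [0, 34, 34, 34, 34]],
  [[0, 0, 0, 0, 0, 24576, 24576], [0, 0, 0, 32768, 40960, 8192, 32768, 16384], [0, 0, 0, 40960,
  40960, 32768, 32768], [0, 2048, 3072, 44056, 44161, 44253, 11460, 17472], [0, 3072, 3072, 44032,
  44032, 11264, 11264, 64], [35328, 51200, 50305, 24668, 26624, 17537, 1696], [35328, 50305,
  50176, 26693, 26624, 1696], [0, 546, 34, 8706]], [[], [], [], [0, 0, 0, 129, 129, 196, 196, 64],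
  [], [0, 0, 129, 69], [0, 129, 0, 69], [0, 34, 34]], [[0, 0, 0, 24576, 0, 0, 24576], [0, 0,
  40960, 32768, 0, 40960, 32768], [0, 3072, 44032, 11264, 3072, 44032, 11264, 64], [35328, 50176,
  26624, 52248, 50305, 26693, 1696], [0, 0, 40960, 32768], [0, 3072, 44161, 11460], [35328, 50305,
  26624, 1696], [0, 34]], [[0, 0, 0, 24576, 0, 24576], [0, 44032, 3072, 11264, 3072, 11264, 44032,
  64], [0, 40960, 0, 8192, 0, 32768], [35328, 26624, 51200, 17537, 50305, 1696], [0, 40960, 0,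
  32768], [35328, 26624, 50305, 1696], [0, 44161]], [[0, 4096, 4096, 4096, 4096, 4096, 4096],
  [256, 0, 0, 4096, 0, 0, 4368], [256, 0, 0, 0, 0, 4368], [256, 256, 0, 4368, 4368], [256, 0, 0,
  4368], [256, 0, 4368], [256, 4368]]]

lemma validTable_six : ValidTable 6 tableSix := by
  refine ⟨by decide, ?_, ?_⟩ <;> decide +kernel

lemma validTable_fourteen : ValidTable 14 tableFourteen := by
  refine ⟨by decide, ?_, ?_⟩ <;> decide +kernel

/-- Names for the functionals used to detect monomials. -/
inductive Key
  | full (v : ℕ)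
  | flag (u v w : ℕ)
  | extra (k : ℕ)

/-- The functional in degree `2 ^ (t + 2) - 1` with the given name. -/
noncomputable def Key.fn (t : ℕ) (T : List (List (List ℕ))) : Key → Expo → ZMod 2
  | .full v => pullSpike (t + 2) 0 v 0
  | .flag u v w => HitProblem.flag t u v w
  | .extra k => HitProblem.extra (2 * (2 ^ t - 1)) T k

/-- Names `.flag u v w` are admissible if `u` is orthogonal to `v` and `w`, and names `.extra i` if
`k = 0` and `T` is a valid table. -/
def Key.Valid (t k : ℕ) (T : List (List (List ℕ))) : Key → Prop
  | .full v => v < 16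
  | .flag u v w => v < 16 ∧ w < 16 ∧ ∑ i : Fin 4, digit u i * digit v i = 0 ∧
      ∑ i : Fin 4, digit u i * digit w i = 0
  | .extra i => i < 4 ∧ k = 0 ∧ ValidTable (2 * (2 ^ t - 1)) T

lemma Key.Valid.annihilated {t k : ℕ} {T : List (List (List ℕ))} {κ : Key} (h : κ.Valid t k T) :
    Annihilated (κ.fn t T) := by
  cases κ with
  | full v => exact annihilated_pullSpike _ _ _ _
  | flag u v w => exact annihilated_flag _ _ _ _ h.2.2.1 h.2.2.2
  | extra i => exact annihilated_extra h.2.2 h.1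

/-- Repetition of the last letter of a word. -/
def stretch (j : ℕ) (x : List ℕ) : List ℕ := x ++ List.replicate j (x.getLastD 0)

lemma stretch_zero (x : List ℕ) : stretch 0 x = x := by simp [stretch]

lemma getLastD_mem {x : List ℕ} (hx : x ≠ []) : x.getLastD 0 ∈ x := by
  rw [List.getLastD_eq_getLast?, List.getLast?_eq_some_getLast hx]
  exact List.getLast_mem hx

lemma mem_stretch {j : ℕ} {x : List ℕ} (hx : j = 0 ∨ x ≠ []) {c : ℕ} : c ∈ stretch j x ↔ c ∈ x := by
  rw [stretch, List.mem_append, List.mem_replicate]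
  refine ⟨?_, Or.inl⟩
  rintro (h | ⟨h1, rfl⟩)
  · exact h
  · exact getLastD_mem (hx.resolve_left h1)

lemma all_stretch {j : ℕ} {x : List ℕ} (hx : j = 0 ∨ x ≠ []) (p : ℕ → Bool) :
    (stretch j x).all p = x.all p := by
  rw [Bool.eq_iff_iff]
  simp only [List.all_eq_true, mem_stretch hx]

lemma stretch_cons {j : ℕ} {x : List ℕ} (hx : j = 0 ∨ x ≠ []) (c : ℕ) :
    stretch j (c :: x) = c :: stretch j x := by
  rcases hx with rfl | hx
  · simp [stretch]
  · cases x with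
    | nil => exact absurd rfl hx
    | cons d x => simp [stretch]

/-- Compressed words: `.inl` is used for words whose letters mostly have weight 1, and `.inr` for
words with a letter of weight 3 followed by letters of weight 2 and a final zero. -/
abbrev Word := List ℕ ⊕ List ℕ

/-- The word described by a compressed word. -/
def expand (j k : ℕ) : Word → List ℕ
  | .inl x => stretch j x
  | .inr x => stretch k x ++ [0]

/-- The value of a functional on a compressed word. -/
def Key.val (T : List (List (List ℕ))) : Key → Word → Bool
  | .full v, .inl x => x.all fun c => c ||| v == v
  | .full v, .inr x => x.all fun c => c ||| v == v
  | .flag u v w, .inr x => liftVal (fun i y => u.testBit i && y.all (minor v w)) x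
  | .extra k, .inr x => liftVal (fun i y => (lookup T (toExpo y)).testBit (4 * k + i)) x
  | _, .inl _ => false

/-- Well-formedness of compressed words. -/
def WellFormed (n : ℕ) : Word → Bool
  | .inl (c :: x) => pop c != 3 && (c :: x).all fun d => d < 16
  | .inr (c :: x) => c < 16 && x.length == n && x.all fun d => d < 16 && pop d == 2
  | _ => false

lemma toExpo_append_zero (x : List ℕ) : toExpo (x ++ [0]) = toExpo x := by
  rw [toExpo_append, show toExpo [0] = 0 from rfl, smul_zero, add_zero]

lemma deg_toExpo {x : List ℕ} {m : ℕ} (hx : ∀ c ∈ x, pop c = m) :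
    deg (toExpo x) = m * (2 ^ x.length - 1) := by
  induction x with
  | nil => rfl
  | cons c x ih =>
    have hc : deg (bits c) = m := hx c (by simp)
    have := Nat.one_le_two_pow (n := x.length)
    rw [toExpo, deg_add, deg_nsmul, hc, ih fun d hd => hx d (by simp [hd]), List.length_cons, pow_succ,
      show 2 ^ x.length * 2 - 1 = 1 + 2 * (2 ^ x.length - 1) by omega]
    ring

lemma wellFormed_inr_cons {n c : ℕ} {x : List ℕ} (h : WellFormed n (.inr (c :: x))) :
    c < 16 ∧ x.length = n ∧ ∀ d ∈ x, d < 16 ∧ pop d = 2 := by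
  simpa [WellFormed, and_assoc] using h

lemma wellFormed_inl_cons {n c : ℕ} {x : List ℕ} (h : WellFormed n (.inl (c :: x))) :
    pop c ≠ 3 ∧ ∀ d ∈ c :: x, d < 16 := by
  simpa [WellFormed, and_assoc] using h

lemma expand_inr_cons {n k c : ℕ} (j : ℕ) {x : List ℕ} (hk : k = 0 ∨ 0 < n) (hn : x.length = n) :
    expand j k (.inr (c :: x)) = c :: (stretch k x ++ [0]) := by
  rw [expand, stretch_cons (hk.imp_right fun h => List.ne_nil_of_length_pos (hn ▸ h)),
    List.cons_append]

lemma lt_of_mem_expand {n j k : ℕ} {W : Word} (hW : WellFormed n W) :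
    ∀ c ∈ expand j k W, c < 16 := by
  rcases W with (_ | ⟨c, x⟩) | (_ | ⟨c, x⟩)
  · exact absurd hW (by simp [WellFormed])
  · intro d hd
    rw [expand, mem_stretch (.inr (by simp))] at hd
    exact (wellFormed_inl_cons hW).2 d hd
  · exact absurd hW (by simp [WellFormed])
  · intro d hd
    obtain ⟨h1, -, h2⟩ := wellFormed_inr_cons hW
    rw [expand, List.mem_append, mem_stretch (.inr (by simp)), List.mem_cons] at hd
    rcases hd with (rfl | hd) | hd
    · exact h1
    · exact (h2 d hd).1
    · simp only [List.mem_singleton] at hd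
      omega

lemma all_expand (T : List (List (List ℕ))) (v j k : ℕ) {n : ℕ} {W : Word} (hW : WellFormed n W) :
    (expand j k W).all (fun c => c ||| v == v) = (Key.full v).val T W := by
  rcases W with (_ | ⟨c, x⟩) | (_ | ⟨c, x⟩)
  · exact absurd hW (by simp [WellFormed])
  · rw [expand, all_stretch (.inr (by simp)), Key.val]
  · exact absurd hW (by simp [WellFormed])
  · rw [expand, List.all_append, all_stretch (.inr (by simp)), Key.val]
    simp

lemma lift_toExpo_expand {n k : ℕ} (j : ℕ) (hk : k = 0 ∨ 0 < n) {c : ℕ} {x : List ℕ}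
    (hW : WellFormed n (.inr (c :: x))) {e : Fin 4 → Expo → ZMod 2} {p : ℕ → List ℕ → Bool}
    (h : ∀ i : Fin 4, e i (toExpo (stretch k x)) = (p i x).toNat) :
    lift e (toExpo (expand j k (.inr (c :: x)))) = (liftVal p (c :: x)).toNat := by
  obtain ⟨h1, h2, h3⟩ := wellFormed_inr_cons hW
  rw [expand_inr_cons j hk h2]
  exact lift_toExpo (p := fun i _ => p i x) h1 fun i => by rw [toExpo_append_zero, h]

lemma lift_toExpo_expand_inl {n j k : ℕ} {x : List ℕ} (hW : WellFormed n (.inl x))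
    (e : Fin 4 → Expo → ZMod 2) : lift e (toExpo (expand j k (.inl x))) = 0 := by
  cases x with
  | nil => exact absurd hW (by simp [WellFormed])
  | cons c x =>
    obtain ⟨h1, h2⟩ := wellFormed_inl_cons hW
    rw [expand, stretch, List.cons_append]
    exact lift_toExpo_eq_zero (h2 c (by simp)) h1 _

lemma Key.Valid.fn_toExpo {t n k : ℕ} {T : List (List (List ℕ))} {κ : Key} (h : κ.Valid t k T)
    (hn : n + k = t) (hk : k = 0 ∨ 0 < n) (j : ℕ) {W : Word} (hW : WellFormed n W)
    (hd : deg (toExpo (expand j k W)) = 2 ^ (t + 2) - 1) :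
    κ.fn t T (toExpo (expand j k W)) = (κ.val T W).toNat := by
  cases κ with
  | full v =>
    rw [Key.fn, pullSpike_zero_right _ _ hd, digit_pow_toExpo h (lt_of_mem_expand hW),
      all_expand T v j k hW]
  | flag u v w =>
    rcases W with x | (_ | ⟨c, x⟩)
    · rw [Key.fn, HitProblem.flag, lift_toExpo_expand_inl hW]
      simp [Key.val]
    · exact absurd hW (by simp [WellFormed])
    · rw [Key.fn, Key.val]
      refine lift_toExpo_expand j hk hW fun i => ?_
      obtain ⟨h1, h2, h3⟩ := wellFormed_inr_cons hW
      have hx : k = 0 ∨ x ≠ [] := hk.imp_right fun h => List.ne_nil_of_length_pos (h2 ▸ h)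
      have h4 := pullSpike_toExpo h.1 h.2.1 (x := stretch k x) fun d hd =>
        h3 d ((mem_stretch hx).1 hd)
      rw [show (stretch k x).length = t by rw [stretch, List.length_append, List.length_replicate,
        h2, hn], all_stretch hx] at h4
      rw [Pi.smul_apply, h4, cast_toNat_and, digit, smul_eq_mul]
      cases u.testBit i <;> simp
  | extra i =>
    obtain ⟨-, rfl, -⟩ := h
    rcases W with x | (_ | ⟨c, x⟩)
    · rw [Key.fn, HitProblem.extra, lift_toExpo_expand_inl hW]
      simp [Key.val]
    · exact absurd hW (by simp [WellFormed])
    · rw [Key.fn, Key.val]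
      refine lift_toExpo_expand j hk hW fun l => ?_
      obtain ⟨h1, h2, h3⟩ := wellFormed_inr_cons hW
      rw [stretch_zero, tableFn, if_pos, digit]
      · cases (lookup T (toExpo x)).testBit (4 * i + l) <;> simp
      · rw [deg_toExpo fun d hd => (h3 d hd).2, h2, ← hn, add_zero]

lemma digit_bit (b : Bool) (n j : ℕ) :
    digit (Nat.bit b n) j = match j with
      | 0 => (b.toNat : ZMod 2)
      | j + 1 => digit n j := by
  cases j with
  | zero => cases b <;> simp [digit]
  | succ j => simp only [digit, Nat.testBit_bit_succ]

/-- The number with the given binary digits. -/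
def packBits : List Bool → ℕ
  | [] => 0
  | b :: l => Nat.bit b (packBits l)

lemma digit_packBits {l : List Bool} {j : ℕ} (hj : j < l.length) :
    digit (packBits l) j = (l[j].toNat : ZMod 2) := by
  induction l generalizing j with
  | nil => exact absurd hj (by simp)
  | cons b l ih =>
    rw [packBits, digit_bit]
    cases j with
    | zero => rfl
    | succ j => exact ih (by simpa using hj)

/-- The bitwise sum modulo 2 of the numbers in a list selected by the binary digits of `m`. -/
def combine : ℕ → List ℕ → ℕ
  | _, [] => 0
  | m, c :: l => bif m % 2 == 1 then c ^^^ combine (m / 2) l else combine (m / 2) l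

lemma exists_annihilated_combine {t k : ℕ} {T : List (List (List ℕ))} {keys : List Key}
    (hkeys : ∀ κ ∈ keys, κ.Valid t k T) {Ws : List Word} {f : Word → Expo}
    (hf : ∀ κ ∈ keys, ∀ W ∈ Ws, κ.fn t T (f W) = (κ.val T W).toNat) (m : ℕ) :
    ∃ φ, Annihilated φ ∧ ∀ l (hl : l < Ws.length),
      φ (f Ws[l]) = digit (combine m (keys.map fun κ => packBits (Ws.map (κ.val T)))) l := by
  induction keys generalizing m with
  | nil => exact ⟨0, annihilated_zero, fun l hl => by simp [combine, digit_zero]⟩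
  | cons κ keys ih =>
    obtain ⟨φ, h1, h2⟩ := ih (fun κ h => hkeys κ (by simp [h])) (fun κ h => hf κ (by simp [h])) (m / 2)
    rw [List.map_cons, combine]
    cases m % 2 == 1 with
    | false => exact ⟨φ, h1, h2⟩
    | true =>
      refine ⟨κ.fn t T + φ, (hkeys κ (by simp)).annihilated.add h1, fun l hl => ?_⟩
      rw [cond_true, digit_xor, ← h2 l hl, Pi.add_apply, hf κ (by simp) _ (List.getElem_mem hl),
        digit_packBits (by simpa using hl), List.getElem_map]

lemma digit_two_pow (k l : ℕ) : digit (2 ^ k) l = if l = k then 1 else 0 := by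
  simp [digit, Nat.testBit_two_pow, eq_comm]

/-- A monomial basis detected by dual functionals computes the dimension of `QP`. -/
lemma finrank_QP {L : ℕ} {words : List (List ℕ)}
    (hdeg : ∀ w ∈ words, deg (toExpo w) = 2 ^ L - 1)
    (hspan : ∀ w : List ℕ, w.length = L → (∀ c ∈ w, c < 16) → deg (toExpo w) = 2 ^ L - 1 →
      ¬ Reducible w → w ∈ words)
    (hdual : ∀ k < words.length, ∃ φ, Annihilated φ ∧ ∀ l (hl : l < words.length),
      φ (toExpo words[l]) = if l = k then 1 else 0) :
    Module.finrank (ZMod 2) (QP 4 (2 ^ L - 1)) = words.length := by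
  set n := 2 ^ L - 1
  let b : Fin words.length → homogeneousSubmodule (Fin 4) (ZMod 2) n := fun l =>
    ⟨mon (toExpo words[l]), by
      have h := hdeg _ (List.getElem_mem l.2)
      exact (mem_homogeneousSubmodule _ _).2 (h ▸ isHomogeneous_mon _)⟩
  let H := (hitSubmodule 4).comap (homogeneousSubmodule (Fin 4) (ZMod 2) n).subtype
  have hmon : ∀ f ∈ homogeneousSubmodule (Fin 4) (ZMod 2) n,
      f ∈ hitSubmodule 4 ⊔ Submodule.span (ZMod 2) (Set.range fun l => (b l : P4)) := by
    intro f hf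
    rw [f.as_sum]
    refine Submodule.sum_mem _ fun d hd => ?_
    rw [← mul_one (coeff d f), ← smul_eq_mul, ← smul_monomial, monomial_eq_mon]
    refine Submodule.smul_mem _ _ ?_
    have hdn : deg (d 0, d 1, d 2, d 3) = n := by
      have h := (mem_homogeneousSubmodule _ _).1 hf (mem_support_iff.1 hd)
      rw [← h, Finsupp.weight_apply, Finsupp.sum_fintype _ _ (by simp), Fin.sum_univ_four]
      simp [deg]
    refine (sup_le_sup_left (Submodule.span_mono ?_) _ :
      hitSubmodule 4 ⊔ _ ≤ hitSubmodule 4 ⊔ _) (mon_mem_hit_sup_span (B := {w | w ∈ words}) hspan _ hdn)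
    rintro _ ⟨w, hw, rfl⟩
    obtain ⟨l, hl, rfl⟩ := List.getElem_of_mem hw
    exact ⟨⟨l, hl⟩, rfl⟩
  have hli : LinearIndependent (ZMod 2) fun l => H.mkQ (b l) := by
    rw [Fintype.linearIndependent_iff]
    intro g hg k
    obtain ⟨φ, hφ, hφk⟩ := hdual k k.2
    let F : QP 4 n →ₗ[ZMod 2] ZMod 2 :=
      H.liftQ (functional φ ∘ₗ (homogeneousSubmodule (Fin 4) (ZMod 2) n).subtype)
        fun f hf => hφ.functional_eq_zero hf
    have hF : ∀ l, F (H.mkQ (b l)) = if l = k then 1 else 0 := by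
      intro l
      refine (functional_mon φ _).trans ((hφk l l.2).trans ?_)
      simp only [Fin.ext_iff]
    have h := congrArg F hg
    simpa only [map_sum, map_smul, hF, smul_eq_mul, mul_ite, mul_one, mul_zero,
      Finset.sum_ite_eq', Finset.mem_univ, if_true, map_zero] using h
  have hsp : ⊤ ≤ Submodule.span (ZMod 2) (Set.range fun l => H.mkQ (b l)) := by
    rintro x -
    obtain ⟨f, rfl⟩ := H.mkQ_surjective x
    obtain ⟨h, hh, g, hg, hfg⟩ := Submodule.mem_sup.1 (hmon f.1 f.2)
    have hg' : g ∈ (Submodule.span (ZMod 2) (Set.range b)).map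
        (homogeneousSubmodule (Fin 4) (ZMod 2) n).subtype := by
      rw [Submodule.map_span, ← Set.range_comp]
      exact hg
    obtain ⟨g', hg'', rfl⟩ := hg'
    have hfg' : H.mkQ f = H.mkQ g' := by
      rw [← sub_eq_zero, ← map_sub, Submodule.mkQ_apply, Submodule.Quotient.mk_eq_zero]
      refine Submodule.mem_comap.2 ?_
      rw [map_sub, Submodule.subtype_apply, ← hfg, add_sub_cancel_right]
      exact hh
    rw [hfg']
    have := Submodule.mem_map_of_mem (f := H.mkQ) hg''
    rwa [Submodule.map_span, ← Set.range_comp] at this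
  rw [Module.finrank_eq_card_basis (Module.Basis.mk hli hsp), Fintype.card_fin]

/-- The letters of weight `k`. -/
def letters (k : ℕ) : List ℕ := (List.range 16).filter fun c => pop c == k

/-- The words obtained from those in a list by prepending a letter of weight `k` without creating
the leading word of a rule at the front. -/
def extend (k : ℕ) (ws : List (List ℕ)) : List (List ℕ) :=
  (letters k).flatMap fun c => (ws.filter fun w => !decide (HeadReducible (c :: w))).map (c :: ·)

/-- The irreducible words of length `t` with all letters of weight `k`. -/
def weightWords (k : ℕ) : ℕ → List (List ℕ)
  | 0 => [[]]
  | t + 1 => extend k (weightWords k t)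

lemma mem_letters {k c : ℕ} : c ∈ letters k ↔ c < 16 ∧ pop c = k := by simp [letters]

lemma mem_extend {k : ℕ} {ws : List (List ℕ)} {x : List ℕ} :
    x ∈ extend k ws ↔ ∃ c w, x = c :: w ∧ (c < 16 ∧ pop c = k) ∧ w ∈ ws ∧ ¬ HeadReducible (c :: w) := by
  simp only [extend, List.mem_flatMap, mem_letters, List.mem_map, List.mem_filter,
    Bool.not_eq_eq_eq_not, Bool.not_true, decide_eq_false_iff_not]
  constructor
  · rintro ⟨c, hc, w, ⟨hw, h⟩, rfl⟩
    exact ⟨c, w, rfl, hc, hw, h⟩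
  · rintro ⟨c, w, rfl, hc, hw, h⟩
    exact ⟨c, hc, w, ⟨hw, h⟩, rfl⟩

lemma length_of_mem_weightWords {k t : ℕ} {w : List ℕ} (h : w ∈ weightWords k t) : w.length = t := by
  induction t generalizing w with
  | zero => simp_all [weightWords]
  | succ t ih =>
    obtain ⟨c, w, rfl, -, hw, -⟩ := mem_extend.1 h
    rw [List.length_cons, ih hw]

lemma pop_of_mem_weightWords {k t : ℕ} {w : List ℕ} (h : w ∈ weightWords k t) :
    ∀ c ∈ w, c < 16 ∧ pop c = k := by
  induction t generalizing w with
  | zero => simp_all [weightWords]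
  | succ t ih =>
    obtain ⟨c, w, rfl, hc, hw, -⟩ := mem_extend.1 h
    intro d hd
    rcases List.mem_cons.1 hd with rfl | hd
    exacts [hc, ih hw d hd]

lemma deg_toExpo_cons (c : ℕ) (w : List ℕ) :
    deg (toExpo (c :: w)) = pop c + 2 * deg (toExpo w) := by
  rw [toExpo, deg_add, deg_nsmul, pop]

lemma headReducible_zero : ∀ c < 16, c ≠ 0 → HeadReducible [0, c] := by decide +kernel

lemma headReducible_fifteen : ∀ c < 16, pop c = 2 ∨ pop c = 3 → HeadReducible [c, 15] := by
  decide +kernel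

lemma headReducible_one_three : ∀ c < 16, ∀ d < 16, pop c = 1 ∧ pop d = 3 →
    HeadReducible [c, d] ∨ c = 8 ∧ d = 7 := by
  decide +kernel

lemma headReducible_eight_seven : ∀ c < 16,
    (pop c = 2 → HeadReducible [8, 7, c] ∨ HeadReducible [7, c]) ∧ (pop c = 1 → HeadReducible [c, 8, 7]) := by
  decide +kernel

lemma pop_le : ∀ c < 16, pop c ≤ 4 ∧ (pop c = 0 → c = 0) ∧ (pop c = 4 → c = 15) := by decide +kernel

lemma eq_zero_of_not_reducible {w : List ℕ} (hw : ∀ c ∈ w, c < 16) (h : ¬ Reducible (0 :: w)) :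
    deg (toExpo w) = 0 := by
  induction w with
  | nil => rfl
  | cons c w ih =>
    have hc : c = 0 := by
      by_contra hc
      exact h (.inl ((headReducible_zero c (hw c (by simp)) hc).append w))
    subst hc
    rw [deg_toExpo_cons, ih (fun d hd => hw d (by simp [hd])) fun h' => h (.inr h')]
    rfl

lemma mem_weightWords_two {w : List ℕ} (hw : ∀ c ∈ w, c < 16)
    (hd : deg (toExpo w) + 2 = 2 ^ w.length) {c : ℕ} (hc : c < 16) (hc' : pop c = 2 ∨ pop c = 3)
    (h : ¬ Reducible (c :: w)) :
    ∃ v, w = v ++ [0] ∧ v ∈ weightWords 2 (w.length - 1) := by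
  induction w generalizing c with
  | nil => simp at hd
  | cons d w ih =>
    have hw' : ∀ c ∈ w, c < 16 := fun c hc => hw c (by simp [hc])
    have hd16 := hw d (by simp)
    obtain ⟨hp, hp0, hp4⟩ := pop_le d hd16
    rw [deg_toExpo_cons, List.length_cons, pow_succ] at hd
    have hnr : ¬ Reducible (d :: w) := fun h' => h (.inr h')
    have h4 : pop d ≠ 4 := fun h4 => h (.inl (by
      have := (headReducible_fifteen c hc hc').append w
      rwa [← hp4 h4] at this))
    rcases Nat.eq_zero_or_pos (pop d) with h0 | h0
    · obtain rfl := hp0 h0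
      have := eq_zero_of_not_reducible hw' hnr
      have hlen : w.length = 0 := by
        by_contra hne
        have := Nat.one_lt_two_pow hne
        omega
      rw [List.length_eq_zero_iff] at hlen
      subst hlen
      exact ⟨[], rfl, by simp [weightWords]⟩
    · obtain ⟨v, rfl, hv⟩ := ih hw' (by omega) hd16 (by omega) hnr
      refine ⟨d :: v, rfl, ?_⟩
      simp only [List.length_cons, List.length_append, List.length_nil, Nat.add_sub_cancel,
        zero_add] at hv ⊢
      exact mem_extend.2 ⟨d, v, rfl, ⟨hd16, by omega⟩, hv, fun h' => hnr (.inl (h'.append [0]))⟩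

lemma classification {w : List ℕ} (hw : ∀ c ∈ w, c < 16) (hd : deg (toExpo w) = 2 ^ w.length - 1)
    (h : ¬ Reducible w) : w ∈ weightWords 1 w.length ∨
      (∃ x ∈ extend 3 (weightWords 2 (w.length - 2)), w = x ++ [0]) ∨ w = [8, 7, 0] := by
  induction w with
  | nil => exact .inl (by simp [weightWords])
  | cons c w ih =>
    have hw' : ∀ c ∈ w, c < 16 := fun c hc => hw c (by simp [hc])
    have hc := hw c (by simp)
    have hp := (pop_le c hc).1
    have hpos := Nat.one_le_two_pow (n := w.length)
    rw [deg_toExpo_cons, List.length_cons, pow_succ] at hd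
    have hnr : ¬ Reducible w := fun h' => h (.inr h')
    have hnh : ¬ HeadReducible (c :: w) := fun h' => h (.inl h')
    obtain h1 | h3 : pop c = 1 ∨ pop c = 3 := by omega
    · rcases ih hw' (by omega) hnr with hA | ⟨x, hx, rfl⟩ | rfl
      · exact .inl (mem_extend.2 ⟨c, w, rfl, ⟨hc, h1⟩, hA, hnh⟩)
      · obtain ⟨d, v, rfl, ⟨hd16, hd3⟩, hv, -⟩ := mem_extend.1 hx
        rcases headReducible_one_three c hc d hd16 ⟨h1, hd3⟩ with h' | ⟨rfl, rfl⟩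
        · exact absurd (by simpa using h'.append (v ++ [0])) hnh
        · cases v with
          | nil => exact Or.inr (Or.inr (by simp))
          | cons e v =>
            have he := pop_of_mem_weightWords hv e (by simp)
            rcases (headReducible_eight_seven e he.1).1 he.2 with h' | h'
            · exact absurd (by simpa using h'.append (v ++ [0])) hnh
            · exact absurd (.inl (by simpa using h'.append (v ++ [0]))) hnr
      · exact absurd (((headReducible_eight_seven c hc).2 h1).append [0]) hnh
    · obtain ⟨v, rfl, hv⟩ := mem_weightWords_two hw' (by omega) hc (.inr h3) h
      refine .inr (.inl ⟨c :: v, mem_extend.2 ⟨c, v, rfl, ⟨hc, h3⟩, ?_, fun h' => hnh (h'.append [0])⟩, rfl⟩)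
      simpa using hv

lemma headReducible_stretch {c j : ℕ} {u : List ℕ} (hu : u ≠ []) (h : HeadReducible (c :: u)) :
    HeadReducible (c :: stretch j u) := by
  rw [← stretch_cons (.inr hu), stretch]
  exact h.append _

lemma stretch_stretch {i j : ℕ} {x : List ℕ} :
    stretch j (stretch i x) = stretch (i + j) x := by
  have : (stretch i x).getLastD 0 = x.getLastD 0 := by
    rw [stretch]
    cases i with
    | zero => simp
    | succ i => rw [List.replicate_succ', ← List.append_assoc, List.getLastD_concat]
  rw [stretch, this, stretch, stretch, List.append_assoc, List.replicate_append_replicate]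

lemma ne_nil_of_mem_weightWords_four {k : ℕ} {u : List ℕ} (hu : u ∈ weightWords k 4) : u ≠ [] :=
  List.ne_nil_of_length_pos (by rw [length_of_mem_weightWords hu]; decide)

lemma weightWords_stable_step : ∀ k ∈ [1, 2], ∀ x ∈ weightWords k 5,
    x.dropLast ∈ weightWords k 4 ∧ x = stretch 1 x.dropLast := by
  decide +kernel

lemma exists_stretch_of_mem_weightWords {k : ℕ} (hk : k ∈ [1, 2]) {j : ℕ} {w : List ℕ}
    (hw : w ∈ weightWords k (4 + j)) : ∃ u ∈ weightWords k 4, w = stretch j u := by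
  induction j generalizing w with
  | zero => exact ⟨w, hw, (stretch_zero w).symm⟩
  | succ j ih =>
    obtain ⟨c, w, rfl, hc, hw, hh⟩ := mem_extend.1 hw
    obtain ⟨u, hu, rfl⟩ := ih hw
    have hu0 := ne_nil_of_mem_weightWords_four hu
    obtain ⟨h1, h2⟩ := weightWords_stable_step k hk (c :: u)
      (mem_extend.2 ⟨c, u, rfl, hc, hu, fun h => hh (headReducible_stretch hu0 h)⟩)
    refine ⟨_, h1, ?_⟩
    rw [← stretch_cons (.inr hu0), h2, stretch_stretch, ← h2,
      add_comm]

lemma exists_stretch_of_mem_extend {k : ℕ} {x : List ℕ}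
    (hx : x ∈ extend 3 (weightWords 2 (4 + k))) :
    ∃ y ∈ extend 3 (weightWords 2 4), x = stretch k y := by
  obtain ⟨c, w, rfl, hc, hw, hh⟩ := mem_extend.1 hx
  obtain ⟨u, hu, rfl⟩ := exists_stretch_of_mem_weightWords (by simp) hw
  have hu0 := ne_nil_of_mem_weightWords_four hu
  exact ⟨c :: u, mem_extend.2 ⟨c, u, rfl, hc, hu, fun h => hh (headReducible_stretch hu0 h)⟩,
    (stretch_cons (.inr hu0) c).symm⟩

/-- A check that the numbers `combine m cols`, for `m` in a list, are `p, 2 p, 4 p, …`. -/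
def dualCheck (cols : List ℕ) : ℕ → List ℕ → Bool
  | _, [] => true
  | p, m :: ms => combine m cols == p && dualCheck cols (2 * p) ms

lemma combine_of_dualCheck {cols ms : List ℕ} {i : ℕ} (h : dualCheck cols (2 ^ i) ms = true) {k : ℕ}
    (hk : k < ms.length) : combine ms[k] cols = 2 ^ (i + k) := by
  induction ms generalizing i k with
  | nil => exact absurd hk (by simp)
  | cons m ms ih =>
    rw [dualCheck, Bool.and_eq_true, beq_iff_eq, ← pow_succ'] at h
    cases k with
    | zero => exact h.1
    | succ k => rw [List.getElem_cons_succ, ih h.2, add_right_comm, add_assoc]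

/-- The dimension of `QP` from a list of compressed words and a certificate `masks` that the
monomials they describe have dual functionals. -/
lemma finrank_QP_of_dualCheck {t n j k : ℕ} {T : List (List (List ℕ))} {keys : List Key}
    {Ws : List Word} {cols masks : List ℕ} (hn : n + k = t) (hk : k = 0 ∨ 0 < n)
    (hone : ∀ w ∈ weightWords 1 (t + 2), w ∈ Ws.map (expand j k))
    (hthree : ∀ x ∈ extend 3 (weightWords 2 t), x ++ [0] ∈ Ws.map (expand j k))
    (hspecial : t = 1 → [8, 7, 0] ∈ Ws.map (expand j k))
    (hdeg : ∀ W ∈ Ws, deg (toExpo (expand j k W)) = 2 ^ (t + 2) - 1)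
    (hWs : Ws.all (WellFormed n) = true) (hkeys : ∀ κ ∈ keys, κ.Valid t k T)
    (hcols : keys.map (fun κ => packBits (Ws.map (κ.val T))) = cols)
    (hlen : masks.length = Ws.length) (hmasks : dualCheck cols 1 masks = true) :
    Module.finrank (ZMod 2) (QP 4 (2 ^ (t + 2) - 1)) = Ws.length := by
  rw [← List.length_map (f := expand j k)]
  refine finrank_QP (fun w hw => ?_) (fun w hL hw hd hr => ?_) fun l hl => ?_
  · obtain ⟨W, hW, rfl⟩ := List.mem_map.1 hw
    exact hdeg W hW
  · rcases classification hw (by rw [hd, hL]) hr with h | ⟨x, hx, rfl⟩ | rfl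
    · exact hone w (hL ▸ h)
    · refine hthree x ?_
      rwa [hL] at hx
    · refine hspecial ?_
      simp only [List.length_cons, List.length_nil] at hL
      omega
  · rw [List.length_map] at hl
    obtain ⟨φ, h1, h2⟩ := exists_annihilated_combine hkeys (Ws := Ws)
      (f := fun W => toExpo (expand j k W)) (fun κ hκ W hW =>
        (hkeys κ hκ).fn_toExpo hn hk j (List.all_eq_true.1 hWs W hW) (hdeg W hW)) (masks[l])
    refine ⟨φ, h1, fun i hi => ?_⟩
    rw [List.getElem_map, h2 i (by simpa using hi), hcols,
      combine_of_dualCheck (i := 0) hmasks (hlen ▸ hl), zero_add, digit_two_pow]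

/-- The compressed words of irreducible monomials: words of length `a` with letters of weight 1, words
with a letter of weight 3 followed by `n` letters of weight 2, and one exception. -/
def irreducibleWords (a n : ℕ) : List Word :=
  (if n = 1 then [.inl [8, 7, 0]] else []) ++
    ((weightWords 1 a).map .inl ++ (extend 3 (weightWords 2 n)).map .inr)

/-- The names `.flag u v w` for lines orthogonal to `u`, each with one choice of two points `v`, `w`. -/
def flagKeys : List Key :=
  (List.range 16).flatMap fun u => (List.range 16).flatMap fun v => (List.range 16).flatMap fun w =>
    if 0 < u ∧ 0 < v ∧ v < w ∧ w < v ^^^ w ∧ pop (u &&& v) % 2 = 0 ∧ pop (u &&& w) % 2 = 0 then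
      [.flag u v w] else []

/-- A list of names, including the names `.extra i` for `i < e`. -/
def allKeys (e : ℕ) : List Key :=
  (List.range e).map .extra ++ ((List.range 16).map .full ++ flagKeys)

lemma sum_digit_mul_digit : ∀ u < 16, ∀ v < 16, pop (u &&& v) % 2 = 0 →
    ∑ i : Fin 4, digit u i * digit v i = 0 := by
  decide +kernel

lemma valid_of_mem_allKeys {t k e : ℕ} {T : List (List (List ℕ))}
    (he : e = 0 ∨ e = 4 ∧ k = 0 ∧ ValidTable (2 * (2 ^ t - 1)) T) :
    ∀ κ ∈ allKeys e, κ.Valid t k T := by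
  intro κ hκ
  simp only [allKeys, flagKeys, List.mem_append, List.mem_map, List.mem_flatMap, List.mem_range] at hκ
  obtain ⟨i, hi, rfl⟩ | ⟨v, hv, rfl⟩ | ⟨u, hu, v, hv, w, hw, h⟩ := hκ
  · obtain rfl | ⟨rfl, h1, h2⟩ := he
    · exact absurd hi (Nat.not_lt_zero i)
    · exact ⟨hi, h1, h2⟩
  · exact hv
  · split_ifs at h with h'
    · rw [List.mem_singleton] at h
      subst h
      exact ⟨hv, hw, sum_digit_mul_digit u hu v hv h'.2.2.2.2.1,
        sum_digit_mul_digit u hu w hw h'.2.2.2.2.2⟩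
    · exact absurd h (by simp)

lemma mem_irreducibleWords {a n : ℕ} {W : Word} : W ∈ irreducibleWords a n ↔
    (n = 1 ∧ W = .inl [8, 7, 0]) ∨ (∃ w ∈ weightWords 1 a, .inl w = W) ∨
      ∃ x ∈ extend 3 (weightWords 2 n), .inr x = W := by
  rw [irreducibleWords, List.mem_append, List.mem_append, List.mem_map, List.mem_map]
  split_ifs with h <;> simp [h]

lemma wellFormed_of_mem_irreducibleWords {a n : ℕ} (ha : 0 < a) {W : Word}
    (hW : W ∈ irreducibleWords a n) : WellFormed n W := by
  obtain ⟨-, rfl⟩ | ⟨w, hw, rfl⟩ | ⟨x, hx, rfl⟩ := mem_irreducibleWords.1 hW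
  · rfl
  · have hp := pop_of_mem_weightWords hw
    cases w with
    | nil => exact absurd (length_of_mem_weightWords hw) (by simpa using ha.ne)
    | cons c w =>
      simp only [WellFormed, Bool.and_eq_true, List.all_eq_true, decide_eq_true_eq, bne_iff_ne]
      exact ⟨by rw [(hp c (by simp)).2]; decide, fun d hd => (hp d hd).1⟩
  · obtain ⟨c, w, rfl, hc, hw, -⟩ := mem_extend.1 hx
    simpa [WellFormed, and_assoc, hc.1, length_of_mem_weightWords hw] using
      pop_of_mem_weightWords hw

lemma length_stretch (j : ℕ) (x : List ℕ) : (stretch j x).length = x.length + j := by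
  simp [stretch]

lemma deg_of_mem_irreducibleWords {a n j k : ℕ} (ha : 0 < a) (hk : k = 0 ∨ 0 < n)
    (hn : n = 1 → k = 0 ∧ j = 0) (hj : n + k + 2 = a + j) {W : Word} (hW : W ∈ irreducibleWords a n) :
    deg (toExpo (expand j k W)) = 2 ^ (n + k + 2) - 1 := by
  obtain ⟨h, rfl⟩ | ⟨w, hw, rfl⟩ | ⟨x, hx, rfl⟩ := mem_irreducibleWords.1 hW
  · obtain ⟨rfl, rfl⟩ := hn h
    subst h
    rfl
  · have hl := length_of_mem_weightWords hw
    have h0 : w ≠ [] := List.ne_nil_of_length_pos (hl ▸ ha)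
    rw [expand, deg_toExpo (m := 1) fun c hc => (pop_of_mem_weightWords hw c
      ((mem_stretch (.inr h0)).1 hc)).2, length_stretch, hl, one_mul, hj]
  · obtain ⟨c, w, rfl, hc, hw, -⟩ := mem_extend.1 hx
    have hl := length_of_mem_weightWords hw
    have h0 : k = 0 ∨ w ≠ [] := hk.imp_right fun h => List.ne_nil_of_length_pos (hl ▸ h)
    rw [expand, stretch_cons h0, toExpo_append_zero, deg_toExpo_cons, hc.2,
      deg_toExpo (m := 2) fun c hc => (pop_of_mem_weightWords hw c ((mem_stretch h0).1 hc)).2,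
      length_stretch, hl, pow_add _ (n + k)]
    have := Nat.one_le_two_pow (n := n + k)
    omega

lemma finrank_QP_of_irreducibleWords {a n j k e : ℕ} {T : List (List (List ℕ))}
    {cols masks : List ℕ} (h : j = 0 ∧ k = 0 ∧ a = n + 2 ∨ n = 4 ∧ a = 4 ∧ j = k + 2)
    (he : e = 0 ∨ e = 4 ∧ k = 0 ∧ ValidTable (2 * (2 ^ (n + k) - 1)) T)
    (hcols : (allKeys e).map (fun κ => packBits ((irreducibleWords a n).map (κ.val T))) = cols)
    (hlen : (irreducibleWords a n).length = masks.length) (hmasks : dualCheck cols 1 masks = true) :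
    Module.finrank (ZMod 2) (QP 4 (2 ^ (n + k + 2) - 1)) = masks.length := by
  rw [← hlen]
  have ha : 0 < a := by omega
  have hk : k = 0 ∨ 0 < n := by omega
  refine finrank_QP_of_dualCheck (n := n) (j := j) (k := k) rfl hk (fun w hw => ?_) (fun x hx => ?_)
    (fun ht => ?_)
    (fun W hW => deg_of_mem_irreducibleWords ha hk (by omega) (by omega) hW)
    (List.all_eq_true.2 fun W hW => wellFormed_of_mem_irreducibleWords ha hW)
    (valid_of_mem_allKeys he) hcols hlen.symm hmasks
  · rw [List.mem_map]
    rcases h with ⟨rfl, rfl, rfl⟩ | ⟨rfl, rfl, rfl⟩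
    · exact ⟨.inl w, mem_irreducibleWords.2 (.inr (.inl ⟨w, hw, rfl⟩)), stretch_zero w⟩
    · obtain ⟨u, hu, rfl⟩ := exists_stretch_of_mem_weightWords (by simp) (add_assoc 4 k 2 ▸ hw)
      exact ⟨.inl u, mem_irreducibleWords.2 (.inr (.inl ⟨u, hu, rfl⟩)), rfl⟩
  · rw [List.mem_map]
    rcases h with ⟨rfl, rfl, rfl⟩ | ⟨rfl, rfl, rfl⟩
    · exact ⟨.inr x, mem_irreducibleWords.2 (.inr (.inr ⟨x, hx, rfl⟩)), by rw [expand, stretch_zero]⟩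
    · obtain ⟨u, hu, rfl⟩ := exists_stretch_of_mem_extend hx
      exact ⟨.inr u, mem_irreducibleWords.2 (.inr (.inr ⟨u, hu, rfl⟩)), rfl⟩
  · obtain ⟨rfl, rfl, rfl⟩ : j = 0 ∧ k = 0 ∧ n = 1 := by omega
    exact List.mem_map.2 ⟨_, mem_irreducibleWords.2 (.inl ⟨rfl, rfl⟩), rfl⟩

lemma finrank_QP_three : Module.finrank (ZMod 2) (QP 4 (2 ^ 2 - 1)) = 14 :=
  finrank_QP_of_irreducibleWords (n := 0) (j := 0) (k := 0) (e := 0) (T := []) (cols :=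
  [0, 1, 4, 7, 32, 41, 52, 1087, 512, 577, 644, 2759, 800, 4969, 9140, 16383, 8192, 8192, 8192,
  8192, 8192, 8192, 8192, 4096, 4096, 4096, 4096, 4096, 4096, 4096, 12288, 12288, 12288, 12288,
  12288, 12288, 12288, 2048, 2048, 2048, 2048, 2048, 2048, 2048, 10240, 10240, 10240, 10240, 10240,
  10240, 10240, 6144, 6144, 6144, 6144, 6144, 6144, 6144, 14336, 14336, 14336, 14336, 14336, 14336,
  14336, 1024, 1024, 1024, 1024, 1024, 1024, 1024, 9216, 9216, 9216, 9216, 9216, 9216, 9216, 5120,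
  5120, 5120, 5120, 5120, 5120, 5120, 13312, 13312, 13312, 13312, 13312, 13312, 13312, 3072, 3072,
  3072, 3072, 3072, 3072, 3072, 11264, 11264, 11264, 11264, 11264, 11264, 11264, 7168, 7168, 7168,
  7168, 7168, 7168, 7168, 15360, 15360, 15360, 15360, 15360, 15360, 15360])
    (masks :=
  [2, 14, 4, 50, 84, 16, 770, 1284, 4368, 256, 254, 3854, 13106, 21844])
    (.inl ⟨rfl, rfl, rfl⟩) (.inl rfl) (by decide +kernel) (by decide +kernel) (by decide +kernel)

lemma finrank_QP_seven : Module.finrank (ZMod 2) (QP 4 (2 ^ 3 - 1)) = 35 :=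
  finrank_QP_of_irreducibleWords (n := 1) (j := 0) (k := 0) (e := 0) (T := []) (cols :=
  [0, 2, 8, 14, 128, 146, 200, 229630, 16384, 16642, 17416, 6571790, 24704, 352348562, 27917317320,
  34359738367, 2147483648, 8589934592, 10737418240, 17179869184, 19327352832, 25769803776,
  27917287424, 16777216, 67108864, 83886080, 268435456, 285212672, 335544320, 352321536, 3271557120,
  13086228480, 16357785600, 17448304640, 20719861760, 30534533120, 33806090240, 262144, 2097152,
  2359296, 4194304, 4456448, 6291456, 6553600, 2685665280, 8594128896, 11279794176, 21476933632,
  24162598912, 30071062528, 32756727808, 25952256, 69206016, 95158272, 406847488, 432799744,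
  476053504, 502005760, 3818651648, 13092519936, 16911171584, 21812477952, 25631129600, 26176651264,
  29995302912, 32768, 65536, 98304, 131072, 163840, 196608, 229376, 2147614720, 9126838272,
  11274452992, 18253676544, 20401291264, 27380514816, 29528129536, 16842752, 75530240, 92372992,
  302120960, 318963712, 377651200, 394493952, 3271753728, 13631520768, 16903274496, 18538889216,
  19629473792, 32170409984, 33260994560, 294912, 2686976, 2981888, 5373952, 5668864, 8060928,
  8355840, 2685829120, 9131294720, 10742792192, 22551265280, 25237094400, 31682560000, 33294057472,
  26050560, 77889536, 86573056, 441581568, 467632128, 519471104, 528154624, 3818881024, 13638074368,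
  16365846528, 22903586816, 24540250112, 27813314560, 28358868992])
    (masks :=
  [2269395237928958, 2, 14, 4, 50, 405828369621610135806, 84, 16, 770, 1511828492046, 1284,
  92287794, 742740, 4368, 256, 36893488147419103232, 73786976294838206464, 295147905179352825856,
  137438953472, 1208962715354713871613952, 9481626471616334725120, 274877906944, 1099511627776,
  1208962713102776610586624, 8388608, 37852718839253082636288, 16777216, 141014531178496, 67108864,
  9481626453886709661696, 37852718839252000440320, 65536, 141012366786560, 131072, 524288])
    (.inl ⟨rfl, rfl, rfl⟩) (.inl rfl) (by decide +kernel) (by decide +kernel) (by decide +kernel)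

lemma finrank_QP_fifteen : Module.finrank (ZMod 2) (QP 4 (2 ^ 4 - 1)) = 75 :=
  finrank_QP_of_irreducibleWords (n := 2) (j := 0) (k := 0) (e := 4) (T := tableSix) (cols :=
  [4722366482869645213696, 144115737831669760, 36028797035741184, 34363932672, 0, 1, 4, 7, 64, 73,
  100, 2064511, 16384, 16513, 16900, 27516748679, 24640, 23657229622207689, 31065469941631491797604,
  37778931862957161709567, 1152921504606846976, 295147905179352825856, 370087802978797879296,
  18889465931478580854784, 21251802094418010308608, 28629346802397224108032,
  31065469941631491768320, 137438953472, 8796093022208, 13331578486784, 18014398509481984,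
  19140435855278080, 22526794229874688, 23657229622181888, 1873499231692521472,
  451945660814442102784, 569111420457982099456, 18889483945877090336768, 22433135684960737296384,
  33508542566099350192128, 37167486565594844626944, 2097152, 536870912, 673185792, 17179869184,
  18255708160, 26306674688, 27516731392, 1477180677863505920, 295147905196532695040,
  388858806248312668160, 23621055786385617715200, 26576317861866357391360, 33508510609919707185152,
  36556006405774363328512, 240532848640, 8796629893120, 15634635161600, 27303089920802816,
  29044960093274112, 31956232256356352, 33704699901247488, 2269816376990367744,
  451945660840748777472, 590260344511638011904, 23621078313179847589888, 27762340278342564970496,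
  28629374105487144910848, 32892845866693534154752, 32768, 131072, 229376, 1048576, 1343488,
  1703936, 2064384, 1152921504607895552, 313630678050081374208, 388858806225679450112,
  20070201667384068145152, 22433114291075802595328, 30455826667273602695168,
  32892814497636327325696, 137439084544, 11029476048896, 15633681186816, 20267297835843584,
  21393884938108928, 25345151770853376, 26476205639172096, 1873499231694225408,
  472734296519953383424, 590260344477282435072, 20070220807819923423232, 21251822361715846152192,
  35341941708467376193536, 36556041268266888626176, 2129920, 813826048, 954433536, 21542993920,
  22635905024, 33128316928, 34359705600, 1477180677864849408, 313630678068337082368,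
  370087803000340873216, 24806403208309809217536, 27762313802136929927168, 35341908003827365412864,
  37167451119984433561600, 240533078016, 11030149234688, 13332392312832, 29626362353418240,
  31369057210957824, 34862556316467200, 35445676667699200, 2269816376992432128,
  472734296547470114816, 569111420491110416384, 24806426865539431399424, 26576343207018128244736,
  30455855712233695969280, 31065499567993845186560])
    (masks :=
  [32, 224, 64, 800, 37188636052598456061920, 1344, 256, 12320, 138538465161440, 20544, 8455926560,
  42150561768581550697962536928, 66409792, 69888, 4096, 590295810358705651712,
  4132070672510939561984, 1180591620717411303424, 14757395258967641292800, 24792424035065637371904,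
  4722366482869645213696, 2199023255552, 316951339225204009042215698432, 58031390856584990895898632,
  1267650916626784932439397498880, 7486146819308173012010795008, 463382211415257943900164,
  15393162788864, 316970682628505560480529514504, 4398046511104, 54975581388800,
  2495374620947930736244031488, 1267651068332807317216478363652, 92358976733184, 17592186044416,
  316951339225204009042215698440, 58031390820553994719461376, 134217728,
  162576596298825293803212552273920, 78603790107365522681102336, 1833458786974157094518786,
  316970682628613653467985084424, 939524096, 268435456, 162615845272034175481579865899008,
  42150561772473767678633312256, 162584045413377778250088451145728, 297326091461197824,
  288248558126104577, 162576190084992508028847846850560, 3355443200, 79209433608793294994669570,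
  5637144576, 588714606593, 1073741824, 1267650916626784932439397498884,
  162584043748207810102410097983488, 78603790107365522681102338, 463382211131583942885376,
  1833458786974139779383296, 1048576, 162618340646631883338417905336320,
  162576190084913924426182053330944, 2256197868584961, 1267651068332808194626752086020,
  44973127317389283722072686592, 7340032, 11333765901058048, 2097152,
  162618340646631885319737865928704, 79209433608793554688147458, 26214400, 1, 44040192, 8388608])
    (.inl ⟨rfl, rfl, rfl⟩) (.inr ⟨rfl, rfl, validTable_six⟩) (by decide +kernel) (by decide +kernel)
    (by decide +kernel)

lemma finrank_QP_thirty_one : Module.finrank (ZMod 2) (QP 4 (2 ^ 5 - 1)) = 89 :=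
  finrank_QP_of_irreducibleWords (n := 3) (j := 0) (k := 0) (e := 4) (T := tableFourteen) (cols :=
  [306953821668001915600896, 38685628533511692694847488, 149880359098666450944,
  592714384096091963392, 0, 1, 4, 7, 64, 73, 100, 4161663, 16384, 16513, 16900, 33827079047, 24640,
  810674458644735177, 428129819123938329911915108, 618970019642690137449562111,
  73786976294838206464, 151115727451828646838272, 170078980359602065899520,
  309485009821345068724781056, 311902935247550621912399872, 387007378004133164552814592,
  428129819123938329911885824, 137438953472, 17592186044416, 26525718020096, 576460752303423488,
  594475288251858944, 720593532565323776, 810674458644709376, 115292153896658534400,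
  227854186193752288133120, 256893973486234081689600, 309485010397805821028204544,
  313111903166818003720339456, 406426930297285095368687616, 458439780418078624222019584, 4194304,
  1073741824, 1614807040, 17179869184, 19331547136, 26843545600, 33827061760, 84163269836606013440,
  151115727451845826707456, 172450539894597983666176, 328829003526799854005125120,
  491127526547286247528726528, 406426929573313889926381568, 607470108402504294048202752,
  240547528704, 17593259786240, 31028483719168, 578712569296977920, 898714676139917312,
  723971259129397248, 1152635905954021376, 146421035449289015296, 227854186193779131678720,
  302230306485752310005760, 328829004247393386570448896, 502613270683555066734968832,
  387007378582845733849792512, 585004546034681574108168192, 32768, 131072, 229376, 2097152, 2392064,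
  3276800, 4161536, 73786976294840303616, 153478063614768076324864, 172450539894578352521216,
  310693940252645716327006208, 313111902572339416936873984, 543882039452271875977347072,
  585004545135681299323781120, 137439084544, 22024592326656, 31026843975680, 576462951328776192,
  594478586790019072, 1049363211673174016, 1148453054995988480, 115292153896661811200,
  268143028774805287501824, 302230306485717958623232, 310693940847121004578865152,
  311902935824013573241176064, 577847513958995081602236416, 607470109456124780615073792, 4227072,
  1090650112, 1640202240, 17450401792, 19635929088, 27266252800, 34359705600, 84163269836608405504,
  153478063614787407872000, 170078980359619516301312, 339709930810827893727428608,
  502613269535102011747303424, 577847512806359243352670208, 458439779603600982123085824,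
  240547758080, 22026207133696, 26526808670208, 578996243567476736, 899000274792710144,
  1053620554824974336, 814477696631439360, 146421035449293176832, 268143028774839114563584,
  256893973486261347942400, 339709931621502352372137984, 491127527596649459201900544,
  543882040350986552117264384, 428129819702934573479362560])
    (masks :=
  [32, 224, 64, 800, 37778931862957161713632, 1344, 256, 12320, 140737488416992, 20544, 8590144288,
  39655187392050797548017811424, 67458368, 69888, 4096, 590295810358705651712,
  4132070672510939561984, 1180591620717411303424, 14757395258967641292800, 74967567915555617767424,
  24792424035065637371904, 4722366482869645213696, 2199023255552, 316951339225204009042215698432,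
  316912651237648975489633615872, 1267650916626784932439397498880, 6660156473608892818183707164672,
  6655165675990628485282305933312, 1267650604950595901958534463488, 15393162788864, 4398046511104,
  54975581388800, 279275953455104, 92358976733184, 17592186044416, 19343403589799406651572224,
  58031390820553994719461376, 134217728, 6660165384719093991710985814018,
  20774575029788390505666242316075010, 78603790107365522681102336, 77375974821819137900150784,
  180154980882186240, 939524096, 268435456, 7486146833285169135768043526,
  22073685093941124737308818701025280, 22073599980377948972954814085332992,
  20770455162115513853590588257992704, 20770542185607639743749138310758406, 297326091461197824,
  288247969411497984, 22236263195581555363017373824057358, 20774575940079427589153452472664066,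
  3355443200, 20770542185607642238626239925452806, 17045651456, 5637144576,
  1461606544192169664514432461438986, 1073741824, 151706024706945638727680,
  20770455165293376574277300635303936, 605643501428326364348416, 463382211131583942885376,
  9590536030897890855485440, 1833458786974139779383296, 1048576,
  20770537195449311842052307449544704, 20933153040721714552464443911962624,
  162576190084913924428242554454016, 2256786583191552, 1444758284140544,
  1465766239138198926974900817100800, 1465721008347349043788468820377600, 7340032,
  35446055987314688, 11333765901058048, 2097152, 22236221401253712780565489075093505,
  127264124553158250963383877632, 294357303296, 26214400, 395079873074723553280, 2060501123072,
  588714606592, 133169152, 44040192, 1465848272472202575565231771090945, 8388608])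
    (.inl ⟨rfl, rfl, rfl⟩) (.inr ⟨rfl, rfl, validTable_fourteen⟩) (by decide +kernel)
    (by decide +kernel) (by decide +kernel)

lemma finrank_QP_stable (k : ℕ) :
    Module.finrank (ZMod 2) (QP 4 (2 ^ (4 + k + 2) - 1)) = 85 :=
  finrank_QP_of_irreducibleWords (n := 4) (j := k + 2) (k := k) (e := 0) (T := []) (cols :=
  [0, 1, 4, 7, 64, 73, 100, 4161663, 16384, 16513, 16900, 33827079047, 24640, 135134514539160777,
  34173414276658224443716196, 38685626227668133590597631, 9223372036854775808,
  18889465931478580854784, 21259872544950258237440, 19342813113834066795298816,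
  19645053792109760943751168, 29033109136682578773803008, 34173414276658224443686912, 137438953472,
  17592186044416, 26525718020096, 72057594037927936, 81064930731622400, 108103983242936320,
  135134514539134976, 14411522243559424000, 28481776245099454267392, 32111750036798643896320,
  19342813185891660833226752, 19796174788776589587906560, 31460553194311849053519872,
  37962159475553777821417472, 4194304, 1073741824, 1614807040, 17179869184, 19331547136,
  26843545600, 33827061760, 10520408729843662848, 18889465931495760723968, 21556317486841927303168,
  21760812327015915894865920, 22705314590742649027690496, 31460553082830192933601280,
  37248137322644933028347904, 240547528704, 17593259786240, 31028483719168, 74309411031482368,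
  88066743213228032, 111481709807009792, 143829589423030272, 18302633249853145088,
  28481776245126297812992, 37778792251368709029888, 21760812435119899137802240,
  24141032603866358213509120, 29033109210991989805285376, 34439942002644370686214144, 32768, 131072,
  229376, 2097152, 2392064, 3276800, 4161536, 9223372036856872960, 19184757951846009569280,
  21556317486822296158208, 19493929417746647745691648, 19796174707708360324677632,
  29299628703865850906771456, 34439941914292028828516352, 137439084544, 22024592326656,
  31026843975680, 72059793063280640, 81068229269782528, 112614489180110848, 139646738464997376,
  14411522243562700800, 33517882094976969506816, 37778792251334357647360,
  19493929498811578477314048, 19645053864169554007031808, 33545313016956323167961088,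
  37248137439516697102155776, 4227072, 1090650112, 1640202240, 17450401792, 19635929088,
  27266252800, 34359705600, 10520408729846054912, 19184757951865341116416, 21259872544967708639232,
  23120928237519420874948608, 24141032464219619756834816, 33545312873126801449385984,
  37962159336616079828058112, 240547758080, 22026207133696, 26526808670208, 74593085301981184,
  88352341866020864, 116871832331911168, 138937752525864960, 18302633249857306624,
  33517882095010796568576, 32111750036825910149120, 23120928372653935414083584,
  22705314703357138207801344, 29299628791932594119999488, 34173414351251309745668096])
    (masks :=
  [2, 14, 4, 50, 2361183241434822607102, 84, 16, 770, 8796093026062, 1284, 536884018,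
  2478449212003174846751113214, 4216148, 4368, 256, 36893488147419103232, 258254417031933722624,
  73786976294838206464, 922337203685477580800, 4685472994722226110464, 1549526502191602335744,
  295147905179352825856, 137438953472, 19809458701575250565138481152, 19807040702353060968102100992,
  79228182289174058277462343680, 416259779600555801136481697792, 415947854749414280330144120832,
  79228162809412243872408403968, 962072674304, 274877906944, 3435973836800, 17454747090944,
  5772436045824, 1099511627776, 1208962724362462915723264, 3626961926284624669966336, 8388608,
  1298153811823835644102133468364800, 66571089628548964556996608, 4912736881710345167568896,
  4835998426363696118759424, 11259686305136640, 58720256, 16777216,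
  1298158418754669807530858078273536, 1379605318371320296081801168814080,
  1379599998773621810809675880333312, 1298153447632219615849411766124544, 209997547903647744,
  18582880716324864, 18015498088218624, 1298153796107467947718627207151616, 209715200, 1065353216,
  352321536, 67108864, 9481626544184102420480, 1298153447830836035892331289706496,
  37852718839270397771776, 28961388195723996430336, 599408501931118178467840,
  114591174185883736211456, 65536, 1298158574715581990128269215596544,
  1308322065045107159529027744497664, 10161011880307120276765159653376, 141049161449472,
  90297392758784, 91610389946137432935931301068800, 91607563021709315236779301273600, 458752,
  2215378499207168, 708360368816128, 131072, 1298158574715606682179569651482624,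
  7954007784572390685211492352, 18397331456, 1638400, 24692492067170222080, 128781320192,
  36794662912, 8323072, 2752512, 524288])
    (.inr ⟨rfl, rfl, rfl⟩) (.inl rfl) (by decide +kernel) (by decide +kernel) (by decide +kernel)

end HitProblem

/-- `dim (QP_4)_{2^{s+1} - 1}` equals `14, 35, 75, 89, 85` for `s = 1, 2, 3, 4` and `s ≥ 5`. -/
theorem stmt11 (s : ℕ) (hs : 1 ≤ s) :
    (s = 1 → Module.finrank (ZMod 2) (QP 4 (2 ^ (s + 1) - 1)) = 14) ∧
    (s = 2 → Module.finrank (ZMod 2) (QP 4 (2 ^ (s + 1) - 1)) = 35) ∧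
    (s = 3 → Module.finrank (ZMod 2) (QP 4 (2 ^ (s + 1) - 1)) = 75) ∧
    (s = 4 → Module.finrank (ZMod 2) (QP 4 (2 ^ (s + 1) - 1)) = 89) ∧
    (5 ≤ s → Module.finrank (ZMod 2) (QP 4 (2 ^ (s + 1) - 1)) = 85) := by
  refine ⟨?_, ?_, ?_, ?_, fun h => ?_⟩
  · rintro rfl
    exact HitProblem.finrank_QP_three
  · rintro rfl
    exact HitProblem.finrank_QP_seven
  · rintro rfl
    exact HitProblem.finrank_QP_fifteen
  · rintro rfl
    exact HitProblem.finrank_QP_thirty_one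
  · obtain ⟨k, rfl⟩ := Nat.exists_eq_add_of_le h
    rw [show 5 + k + 1 = 4 + k + 2 by omega]
    exact HitProblem.finrank_QP_stable k
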